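/- arXiv:1807.00658 — 2 statements merged into one kernel-verified Lean document; each statement's English description precedes it below -/
import Mathlib

section
/- Let ⊏ be a linear order on ℚ of order type ω and let < be the usual order of the rationals. Then every finite permutation (A, <₁, <₂) has finite big Ramsey degree in the permutation (ℚ, <, ⊏): there exists a positive integer T such that for every k ≥ 2 and every coloring χ of the set of embeddings of (A, <₁, <₂) into (ℚ, <, ⊏) with k colors there is an embedding w of (ℚ, <, ⊏) into itself such that {χ(w ∘ f) : f an embedding of (A, <₁, <₂) into (ℚ, <, ⊏)} has at most T elements. -/
/-- An embedding of permutations `(A, ra₁, ra₂) → (B, rb₁, rb₂)`: an injective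
map that is strictly increasing with respect to both orders. -/
def PermEmb {A B : Type} (ra₁ ra₂ : A → A → Prop) (rb₁ rb₂ : B → B → Prop)
    (f : A → B) : Prop :=
  Function.Injective f ∧ (∀ x y, ra₁ x y → rb₁ (f x) (f y)) ∧
    (∀ x y, ra₂ x y → rb₂ (f x) (f y))

open Filter

/-- Existence of a special idempotent in a minimal left ideal. -/
theorem exists_min_idem {M : Type*} [Semigroup M] [TopologicalSpace M] [CompactSpace M]
    [T2Space M] (hc : ∀ r : M, Continuous (· * r)) (T : Set M) (hT : IsClosed T)
    (hTm : ∀ x ∈ T, ∀ y ∈ T, x * y ∈ T) (g : M) (hg : g ∈ T) (hgg : g * g = g)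
    (l : M) (hl : l ∈ T) (hlc : Continuous (l * ·)) :
    ∃ f ∈ T, f * f = f ∧ f * g = f ∧ (∃ m ∈ T, f = l * m) ∧
      ∀ z ∈ T, ∃ t, t * (z * f) = f := by
  let S : Set (Set M) :=
    { N | IsClosed N ∧ N.Nonempty ∧ N ⊆ T ∧ ∀ t ∈ T, ∀ m ∈ N, t * m ∈ N }
  have hideal : ∀ m ∈ T, (· * m) '' T ∈ S := by
    intro m hm
    refine ⟨(hc m).isClosedMap _ hT, ⟨_, ⟨m, hm, rfl⟩⟩, ?_, ?_⟩
    · rintro _ ⟨x, hx, rfl⟩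
      exact hTm _ hx _ hm
    · rintro t ht _ ⟨x, hx, rfl⟩
      exact ⟨t * x, hTm _ ht _ hx, mul_assoc _ _ _⟩
  obtain ⟨N, hNsub, hN⟩ : ∃ N, N ⊆ (· * g) '' T ∧ Minimal (· ∈ S) N := by
    refine zorn_superset_nonempty S ?_ _ (hideal g hg)
    intro c hcs hch hcn
    refine ⟨⋂₀ c, ⟨isClosed_sInter fun t ht => (hcs ht).1, ?_, ?_, ?_⟩, fun s hs =>
      Set.sInter_subset_of_mem hs⟩
    · rw [Set.sInter_eq_iInter]
      have := hcn.coe_sort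
      exact IsCompact.nonempty_iInter_of_directed_nonempty_isCompact_isClosed
        ((↑) : c → Set M) (DirectedOn.directed_val (IsChain.directedOn hch.symm))
        (fun i => (hcs i.prop).2.1) (fun i => (hcs i.prop).1.isCompact)
        (fun i => (hcs i.prop).1)
    · obtain ⟨s, hs⟩ := hcn
      exact (Set.sInter_subset_of_mem hs).trans (hcs hs).2.2.1
    · intro t ht m hm
      rw [Set.mem_sInter] at hm ⊢
      exact fun s hs => (hcs hs).2.2.2 t ht m (hm s hs)
  obtain ⟨Nc, Nn, NT, Nid⟩ := hN.prop
  have hmin : ∀ m ∈ N, (· * m) '' T = N := by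
    intro m hm
    apply hN.eq_of_subset (hideal m (NT hm))
    rintro _ ⟨x, hx, rfl⟩
    exact Nid _ hx _ hm
  obtain ⟨f, ⟨m, hm, hfm⟩, hff⟩ := exists_idempotent_in_compact_subsemigroup hc ((l * ·) '' N)
    (Nn.image _) (Nc.isCompact.image hlc) (by
      rintro _ ⟨x, hx, rfl⟩ _ ⟨y, hy, rfl⟩
      exact ⟨x * (l * y), Nid _ (NT hx) _ (Nid _ hl _ hy), by simp [mul_assoc]⟩)
  have hfN : f ∈ N := hfm ▸ Nid _ hl _ hm
  refine ⟨f, NT hfN, hff, ?_, ⟨m, NT hm, hfm.symm⟩, ?_⟩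
  · obtain ⟨t, _, rfl⟩ := hNsub hfN
    simp only [mul_assoc, hgg]
  · intro z hz
    have := hmin _ (Nid z hz f hfN)
    rw [← this] at hfN
    obtain ⟨t, _, ht⟩ := hfN
    exact ⟨t, ht⟩

/-- Reversed words: the head of the list is the latest letter. -/
def RW (α : Type*) : Type _ := List α

/-- underlying list -/
def RW.L {α : Type*} (w : RW α) : List α := w

/-- word from a list -/
def RW.of {α : Type*} (w : List α) : RW α := w

instance RW.sg (α : Type*) : Semigroup (RW α) where
  mul x y := List.append y x
  mul_assoc x y z := (List.append_assoc z y x).symm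

theorem RW.mul_def {α : Type*} (x y : RW α) :
    (x * y).L = y.L ++ x.L := rfl

noncomputable instance RW.usg (α : Type*) : Semigroup (Ultrafilter (RW α)) :=
  Ultrafilter.semigroup

/-- letterwise substitution -/
def RW.map {α β : Type*} (c : α → β) (w : RW α) : RW β := RW.of (List.map c w.L)

theorem RW.map_mul {α β : Type*} (c : α → β) (x y : RW α) :
    RW.map c (x * y) = RW.map c x * RW.map c y := List.map_append

theorem RW.ev_mul {α : Type*} (U V : Ultrafilter (RW α)) (p : RW α → Prop) :
    (∀ᶠ m in (↑(U * V) : Filter (RW α)), p m) ↔ ∀ᶠ m in (U : Filter (RW α)),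
      ∀ᶠ m' in (V : Filter (RW α)), p (m * m') :=
  Iff.rfl

theorem uf_ext {α : Type*} {U V : Ultrafilter α}
    (h : ∀ p : α → Prop, (∀ᶠ m in (U : Filter α), p m) ↔ ∀ᶠ m in (V : Filter α), p m) : U = V :=
  Ultrafilter.coe_inj.mp <| Filter.ext' h

theorem RW.umap_mul {α β : Type*} (c : α → β) (U V : Ultrafilter (RW α)) :
    (U * V).map (RW.map c) = U.map (RW.map c) * V.map (RW.map c) := by
  apply uf_ext
  intro p
  simp only [Ultrafilter.coe_map, Filter.eventually_map, RW.ev_mul, RW.map_mul]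

/-- ultrafilters on words with letters at most `n` -/
def TT (n : ℕ) : Set (Ultrafilter (RW ℕ)) :=
  {U | ∀ᶠ w in (U : Filter (RW ℕ)), ∀ x ∈ w.L, x ≤ n}

theorem TT_closed (n : ℕ) : IsClosed (TT n) :=
  ultrafilter_isClosed_basic {w : RW ℕ | ∀ x ∈ w.L, x ≤ n}

theorem TT_mul (n : ℕ) : ∀ x ∈ TT n, ∀ y ∈ TT n, x * y ∈ TT n := by
  intro x hx y hy
  refine (RW.ev_mul _ _ _).2 ?_
  filter_upwards [hx] with a ha
  filter_upwards [hy] with b hb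
  intro z hz
  rw [RW.mul_def, List.mem_append] at hz
  exact hz.elim (hb z) (ha z)

theorem RW.pure_mul_cont (a : RW ℕ) :
    Continuous ((pure a : Ultrafilter (RW ℕ)) * ·) :=
  ultrafilterBasis_is_basis.continuous_iff.2 <| Set.forall_mem_range.mpr fun s ↦
    ultrafilter_isOpen_basic {m : RW ℕ | a * m ∈ s}

/-- property of the block ultrafilter at stage `n` -/
def FProp (n : ℕ) (f : Ultrafilter (RW ℕ)) : Prop :=
  f ∈ TT n ∧ f * f = f ∧ (∀ᶠ w in (f : Filter (RW ℕ)), ∃ t : List ℕ, w.L = t ++ [n]) ∧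
    ∀ z ∈ TT n, ∃ t, t * (z * f) = f

theorem FProp_step (n : ℕ) (g : Ultrafilter (RW ℕ)) (hg : g ∈ TT n) (hgg : g * g = g) :
    ∃ f, FProp n f ∧ f * g = f := by
  obtain ⟨f, hfT, hff, hfg, ⟨m, hm, hfm⟩, hz⟩ := exists_min_idem
    (fun r : Ultrafilter (RW ℕ) => Ultrafilter.continuous_mul_left r) (TT n) (TT_closed n)
    (TT_mul n) g hg hgg (pure (RW.of [n])) (by
      change ∀ x ∈ [n], x ≤ n
      simp) (RW.pure_mul_cont _)
  refine ⟨f, ⟨hfT, hff, ?_, hz⟩, hfg⟩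
  rw [hfm]
  refine (RW.ev_mul _ _ _).2 ?_
  change ∀ᶠ m' in (m : Filter (RW ℕ)), _
  exact Eventually.of_forall fun m' => ⟨m'.L, rfl⟩

theorem TT_mono {m n : ℕ} (h : m ≤ n) : TT m ⊆ TT n := by
  intro U hU
  change ∀ᶠ w in (U : Filter (RW ℕ)), _
  filter_upwards [hU] with w hw x hx
  exact (hw x hx).trans h

theorem exists_F : ∃ f : ℕ → Ultrafilter (RW ℕ), ∀ n, FProp n (f n) ∧ f (n+1) * f n = f (n+1) := by
  have h0 : ∃ f, FProp 0 f := by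
    obtain ⟨f, hf, -⟩ := FProp_step 0 (pure (RW.of [])) (by
      change ∀ x ∈ ([] : List ℕ), x ≤ 0
      simp) (by
      apply uf_ext
      intro p
      exact Iff.rfl)
    exact ⟨f, hf⟩
  obtain ⟨f0, hf0⟩ := h0
  have step : ∀ n (g : {g // FProp n g}), ∃ f : {g // FProp (n+1) g}, f.1 * g.1 = f.1 := by
    rintro n ⟨g, hg⟩
    obtain ⟨f, hf, hfg⟩ := FProp_step (n+1) g (TT_mono (Nat.le_succ n) hg.1) hg.2.1
    exact ⟨⟨f, hf⟩, hfg⟩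
  choose nx hnx using step
  let st : ∀ n, {g // FProp n g} := fun n => Nat.rec ⟨f0, hf0⟩ (fun n g => nx n g) n
  exact ⟨fun n => (st n).1, fun n => ⟨(st n).2, hnx n (st n)⟩⟩

theorem F_absorb {Γ : Type*} {f : ℕ → Ultrafilter (RW ℕ)}
    (hf : ∀ n, FProp n (f n) ∧ f (n+1) * f n = f (n+1)) (n : ℕ) (c : ℕ → Γ) (j : ℕ) (hj : j ≤ n)
    (hc : c j = c (n+1)) :
    (f n).map (RW.map c) * (f (n+1)).map (RW.map c) = (f n).map (RW.map c) := by
  set y := (f n).map (RW.map c) with hy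
  set y' := (f (n+1)).map (RW.map c) with hy'
  have e1 : y' * y = y' := by rw [hy, hy', ← RW.umap_mul, (hf n).2]
  have e2 : y' * y' = y' := by rw [hy', ← RW.umap_mul, (hf (n+1)).1.2.1]
  let σ : ℕ → ℕ := fun x => if x = n + 1 then j else x
  let z := (f (n+1)).map (RW.map σ)
  have hz : z ∈ TT n := by
    change ∀ᶠ w in (f (n+1) : Filter (RW ℕ)), ∀ x ∈ List.map σ w.L, x ≤ n
    filter_upwards [(hf (n+1)).1.1] with w hw x hx
    obtain ⟨t, ht, rfl⟩ := List.mem_map.1 hx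
    have := hw t ht
    simp only [σ]
    split_ifs <;> omega
  have hzm : z.map (RW.map c) = y' := by
    rw [hy', Ultrafilter.map_map]
    congr 1
    funext w
    change List.map c (List.map σ w.L) = List.map c w.L
    rw [List.map_map]
    congr 1
    funext x
    simp only [σ, Function.comp]
    split_ifs with h
    · rw [h, hc]
    · rfl
  obtain ⟨t, ht⟩ := (hf n).1.2.2.2 z hz
  have e3 : t.map (RW.map c) * y' = y := by
    have := congrArg (Ultrafilter.map (RW.map c)) ht
    rw [RW.umap_mul, RW.umap_mul, hzm, ← hy, e1] at this
    exact this
  calc y * y' = t.map (RW.map c) * y' * y' := by rw [e3]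
    _ = y := by rw [mul_assoc, e2, e3]

theorem uf_color {α κ : Type*} [Finite κ] (U : Ultrafilter α) (g : α → κ) :
    ∃ k, ∀ᶠ z in (U : Filter α), g z = k := by
  obtain ⟨k, hk⟩ := Ultrafilter.eq_pure_of_finite (U.map g)
  refine ⟨k, ?_⟩
  have : ∀ᶠ x in ((U.map g : Ultrafilter κ) : Filter κ), x = k := by
    rw [hk]
    exact (rfl : k = k)
  exact this

section LemmaA

variable {Γ κ : Type*}

/-- invariant of the construction -/
def Gd (f : ℕ → Ultrafilter (RW ℕ)) (χ : List Γ → κ) (n : ℕ) (F : (ℕ → Γ) → List Γ) : Prop :=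
  ∀ c : ℕ → Γ, (∃ j < n, c j = c n) →
    ∀ᶠ z in (f n : Filter (RW ℕ)), χ (z.L.map c ++ F c) = χ (F c)

/-- locality -/
def Loc (n : ℕ) (F : (ℕ → Γ) → List Γ) : Prop :=
  ∀ c c' : ℕ → Γ, (∀ j < n, c j = c' j) → F c = F c'

theorem stepA [Finite Γ] [Finite κ] {f : ℕ → Ultrafilter (RW ℕ)}
    (hf : ∀ n, FProp n (f n) ∧ f (n+1) * f n = f (n+1)) (χ : List Γ → κ) (n : ℕ)
    (F : (ℕ → Γ) → List Γ) (hL : Loc n F) (hG : Gd f χ n F) :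
    ∃ b : List ℕ, (∀ x ∈ b, x ≤ n) ∧ (∃ t, b = t ++ [n]) ∧
      (∀ c : ℕ → Γ, (∃ j < n, c j = c n) → χ (b.map c ++ F c) = χ (F c)) ∧
      Gd f χ (n+1) (fun c => b.map c ++ F c) := by
  have key : ∀ c : ℕ → Γ, ∀ᶠ z in (f n : Filter (RW ℕ)),
      ((∃ j < n, c j = c n) → χ (z.L.map c ++ F c) = χ (F c)) ∧
      ((∃ j < n + 1, c j = c (n+1)) → ∀ᶠ z' in (f (n+1) : Filter (RW ℕ)),
        χ (z'.L.map c ++ (z.L.map c ++ F c)) = χ (z.L.map c ++ F c)) := by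
    intro c
    refine Filter.Eventually.and ?_ ?_
    · by_cases h : ∃ j < n, c j = c n
      · filter_upwards [hG c h] with z hz _ using hz
      · exact Eventually.of_forall fun z hz => absurd hz h
    · by_cases h : ∃ j < n + 1, c j = c (n+1)
      · obtain ⟨k, hk⟩ := uf_color (f n) (fun z => χ (z.L.map c ++ F c))
        obtain ⟨j, hj, hjc⟩ := h
        have hab := F_absorb hf n c j (by omega) hjc
        have h2 : ∀ᶠ m in (((f n).map (RW.map c) : Ultrafilter (RW Γ)) : Filter (RW Γ)),
            χ (m.L ++ F c) = k := hk
        rw [← hab, RW.ev_mul] at h2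
        have h3 : ∀ᶠ z in (f n : Filter (RW ℕ)), ∀ᶠ z' in (f (n+1) : Filter (RW ℕ)),
          χ ((RW.map c z * RW.map c z').L ++ F c) = k := h2
        filter_upwards [hk, h3] with z hz hz3 _
        filter_upwards [hz3] with z' hz'
        rw [hz, ← hz', RW.mul_def, List.append_assoc]
        rfl
      · exact Eventually.of_forall fun z hz => absurd hz h
  let ext : (Fin (n+2) → Γ) → ℕ → Γ := fun v j => if h : j < n + 2 then v ⟨j, h⟩ else v 0
  have key2 := Filter.eventually_all.2 fun v : Fin (n+2) → Γ => key (ext v)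
  obtain ⟨b, hb, hb1, hb2⟩ := (key2.and ((hf n).1.1.and (hf n).1.2.2.1)).exists
  refine ⟨b.L, hb1, hb2, ?_⟩
  have tr : ∀ c : ℕ → Γ, ∃ v, ∀ j < n + 2, c j = ext v j := by
    intro c
    refine ⟨fun j => c j, fun j hj => ?_⟩
    simp [ext, hj]
  have main : ∀ c : ℕ → Γ, 
      ((∃ j < n, c j = c n) → χ (b.L.map c ++ F c) = χ (F c)) ∧
      ((∃ j < n + 1, c j = c (n+1)) → ∀ᶠ z' in (f (n+1) : Filter (RW ℕ)),
        χ (z'.L.map c ++ (b.L.map c ++ F c)) = χ (b.L.map c ++ F c)) := by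
    intro c
    obtain ⟨v, hv⟩ := tr c
    have hFc : F c = F (ext v) := hL _ _ fun j hj => hv j (by omega)
    have hbc : b.L.map c = b.L.map (ext v) :=
      List.map_congr_left fun x hx => hv x (by have := hb1 x hx; omega)
    obtain ⟨p1, p2⟩ := hb v
    rw [hFc, hbc]
    constructor
    · rintro ⟨j, hj, hjc⟩
      exact p1 ⟨j, hj, by rw [← hv j (by omega), ← hv n (by omega), hjc]⟩
    · rintro ⟨j, hj, hjc⟩
      filter_upwards [p2 ⟨j, hj, by rw [← hv j (by omega), ← hv (n+1) (by omega), hjc]⟩,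
        (hf (n+1)).1.1] with z hz hzl
      have : z.L.map c = z.L.map (ext v) :=
        List.map_congr_left fun x hx => hv x (by have := hzl x hx; omega)
      rw [this, hz]
  exact ⟨fun c => (main c).1, fun c => (main c).2⟩

/-- reversed initial segment of a sequence -/
def RR (c : ℕ → Γ) : ℕ → List Γ
  | 0 => []
  | n + 1 => c n :: RR c n

theorem RR_map {Γ' : Type*} (g : Γ → Γ') (c : ℕ → Γ) (n : ℕ) :
    (RR c n).map g = RR (fun j => g (c j)) n := by
  induction n with
  | zero => rfl
  | succ n ih => simp [RR, ih]

theorem RR_length (c : ℕ → Γ) (n : ℕ) : (RR c n).length = n := by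
  induction n with
  | zero => rfl
  | succ n ih => simp [RR, ih]

theorem RR_congr {c c' : ℕ → Γ} {n : ℕ} (h : ∀ j < n, c j = c' j) : RR c n = RR c' n := by
  induction n with
  | zero => rfl
  | succ n ih => simp [RR, ih (fun j hj => h j (by omega)), h n (by omega)]

theorem RR_inj {c c' : ℕ → Γ} {n : ℕ} (h : RR c n = RR c' n) : ∀ j < n, c j = c' j := by
  induction n with
  | zero => intro j hj; omega
  | succ n ih =>
    simp only [RR, List.cons.injEq] at h
    intro j hj
    rcases Nat.lt_succ_iff_lt_or_eq.1 hj with h1 | rfl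
    · exact ih h.2 j h1
    · exact h.1

theorem mem_RR {c : ℕ → Γ} {n : ℕ} {a : Γ} : a ∈ RR c n ↔ ∃ j < n, c j = a := by
  induction n with
  | zero => simp [RR]
  | succ n ih =>
    simp only [RR, List.mem_cons, ih, Nat.lt_succ_iff_lt_or_eq]
    constructor
    · rintro (rfl | ⟨j, hj, rfl⟩)
      · exact ⟨n, Or.inr rfl, rfl⟩
      · exact ⟨j, Or.inl hj, rfl⟩
    · rintro ⟨j, hj | rfl, rfl⟩
      · exact Or.inr ⟨j, hj, rfl⟩
      · exact Or.inl rfl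

theorem RR_split (c : ℕ → Γ) {i n : ℕ} (h : i < n) : ∃ l, RR c n = l ++ c i :: RR c i := by
  induction n with
  | zero => omega
  | succ n ih =>
    rcases Nat.lt_succ_iff_lt_or_eq.1 h with h1 | rfl
    · obtain ⟨l, hl⟩ := ih h1
      exact ⟨c n :: l, by simp [RR, hl]⟩
    · exact ⟨[], rfl⟩

theorem RR_surj [Nonempty Γ] (u : List Γ) : ∃ c, RR c u.length = u := by
  induction u with
  | nil => exact ⟨fun _ => Classical.arbitrary Γ, rfl⟩
  | cons a u ih =>
    obtain ⟨c, hc⟩ := ih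
    refine ⟨fun j => if j < u.length then c j else a, ?_⟩
    simp only [List.length_cons, RR, lt_irrefl, if_false]
    congr 1
    conv_rhs => rw [← hc]
    apply RR_congr
    intro j hj
    simp [hj]

/-- nice natural operators on words -/
structure Nice (w : List Γ → List Γ) : Prop where
  nil : w [] = []
  cons : ∀ a u, ∃ t, w (a :: u) = t ++ a :: w u ∧ ∀ x ∈ t, x ∈ a :: u
  nat : ∀ (g : Γ → Γ) u, w (u.map g) = (w u).map g

theorem lemmaA [Finite Γ] [Nonempty Γ] [Finite κ] (χ : List Γ → κ) :
    ∃ w : List Γ → List Γ, Nice w ∧ ∀ a u, a ∈ u → χ (w (a :: u)) = χ (w u) := by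
  obtain ⟨f, hf⟩ := exists_F
  let St : ℕ → Type _ := fun n => {F : (ℕ → Γ) → List Γ // Loc n F ∧ Gd f χ n F}
  have step : ∀ n (s : St n), ∃ b : List ℕ, (∀ x ∈ b, x ≤ n) ∧ (∃ t, b = t ++ [n]) ∧
      (∀ c : ℕ → Γ, (∃ j < n, c j = c n) → χ (b.map c ++ s.1 c) = χ (s.1 c)) ∧
      Gd f χ (n+1) (fun c => b.map c ++ s.1 c) :=
    fun n s => stepA hf χ n s.1 s.2.1 s.2.2
  choose B hB1 hB2 hB3 hB4 using step
  let st : ∀ n, St n := fun n => Nat.rec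
    ⟨fun _ => [], fun _ _ _ => rfl, fun c ⟨j, hj, _⟩ => absurd hj (Nat.not_lt_zero j)⟩
    (fun n s => ⟨fun c => (B n s).map c ++ s.1 c, fun c c' h => by
      have h1 : (B n s).map c = (B n s).map c' :=
        List.map_congr_left fun x hx => h x (by have := hB1 n s x hx; omega)
      have h2 : s.1 c = s.1 c' := s.2.1 _ _ fun j hj => h j (by omega)
      change (B n s).map c ++ s.1 c = (B n s).map c' ++ s.1 c'
      rw [h1, h2], hB4 n s⟩) n
  let F : ℕ → (ℕ → Γ) → List Γ := fun n => (st n).1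
  let b : ℕ → List ℕ := fun n => B n (st n)
  have F0 : ∀ c, F 0 c = [] := fun c => rfl
  have FS : ∀ n c, F (n+1) c = (b n).map c ++ F n c := fun n c => rfl
  have FL : ∀ n, Loc n (F n) := fun n => (st n).2.1
  have Fnat : ∀ (g : Γ → Γ) n c, F n (fun j => g (c j)) = (F n c).map g := by
    intro g n c
    induction n with
    | zero => rfl
    | succ n ih => rw [FS, FS, ih, List.map_append, List.map_map]; rfl
  choose C hC using (RR_surj : ∀ u : List Γ, _)
  let w : List Γ → List Γ := fun u => F u.length (C u)
  have hw : ∀ c n, w (RR c n) = F n c := by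
    intro c n
    have := hC (RR c n)
    simp only [w]
    rw [RR_length] at this ⊢
    exact FL n _ _ (RR_inj this)
  refine ⟨w, ⟨rfl, ?_, ?_⟩, ?_⟩
  · intro a u
    obtain ⟨c, hc⟩ := RR_surj (a :: u)
    simp only [List.length_cons, RR, List.cons.injEq] at hc
    obtain ⟨t, ht⟩ := hB2 u.length (st u.length)
    have e1 : w (a :: u) = F (u.length + 1) c := by
      rw [← hw]; simp only [RR, hc]
    have e2 : w u = F u.length c := by
      rw [← hw, hc.2]
    refine ⟨t.map c, ?_, ?_⟩
    · rw [e1, e2, FS]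
      simp only [b]
      rw [ht]
      simp [hc.1]
    · intro x hx
      obtain ⟨y, hy, rfl⟩ := List.mem_map.1 hx
      have hyl := hB1 u.length (st u.length) y (by rw [ht]; simp [hy])
      have : c y ∈ RR c (u.length + 1) := mem_RR.2 ⟨y, by omega, rfl⟩
      simpa only [RR, hc] using this
  · intro g u
    obtain ⟨c, hc⟩ := RR_surj u
    rw [← hc, RR_map, hw, hw, Fnat]
  · intro a u hau
    obtain ⟨c, hc⟩ := RR_surj (a :: u)
    simp only [List.length_cons, RR, List.cons.injEq] at hc
    have e1 : w (a :: u) = F (u.length + 1) c := by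
      rw [← hw]; simp only [RR, hc]
    have e2 : w u = F u.length c := by
      rw [← hw, hc.2]
    rw [e1, e2, FS]
    apply hB3
    rw [← hc.2, mem_RR] at hau
    obtain ⟨j, hj, hja⟩ := hau
    exact ⟨j, hj, by rw [hja, hc.1]⟩

end LemmaA

section Iterate

variable {Γ : Type}

theorem Nice.mem {w : List Γ → List Γ} (hw : Nice w) (u : List Γ) (x : Γ) : x ∈ w u ↔ x ∈ u := by
  induction u with
  | nil => rw [hw.nil]
  | cons a u ih =>
    obtain ⟨t, ht, htm⟩ := hw.cons a u
    rw [ht, List.mem_append, List.mem_cons, ih, List.mem_cons]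
    constructor
    · rintro (h | h)
      · exact List.mem_cons.1 (htm x h)
      · exact h
    · exact Or.inr

theorem Nice.split {w : List Γ → List Γ} (hw : Nice w) (l : List Γ) (x : Γ) (p : List Γ) :
    ∃ t, w (l ++ x :: p) = t ++ x :: w p ∧ ∀ y ∈ t, y ∈ l ++ x :: p := by
  induction l with
  | nil => exact hw.cons x p
  | cons a l ih =>
    obtain ⟨t, ht, hm⟩ := ih
    obtain ⟨t', ht', hm'⟩ := hw.cons a (l ++ x :: p)
    refine ⟨t' ++ a :: t, ?_, ?_⟩
    · rw [List.cons_append, ht', ht]; simp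
    · intro y hy
      rw [List.mem_append, List.mem_cons] at hy
      rcases hy with h | h | h
      · exact hm' y h
      · simp [h]
      · exact List.mem_cons_of_mem _ (hm y h)

theorem Nice.comp {w w' : List Γ → List Γ} (hw : Nice w) (hw' : Nice w') :
    Nice (fun u => w (w' u)) where
  nil := by rw [hw'.nil, hw.nil]
  cons a u := by
    obtain ⟨t, ht, hm⟩ := hw'.cons a u
    obtain ⟨s, hs, hsm⟩ := hw.split t a (w' u)
    refine ⟨s, by rw [ht, hs], fun x hx => ?_⟩
    have := hsm x hx
    rw [← ht, hw'.mem] at this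
    exact this
  nat g u := by rw [hw'.nat, hw.nat]

/-- appending an old letter does not change the colour -/
def Inv0 {κ : Type} (χ : List Γ → κ) : Prop := ∀ a u, a ∈ u → χ (a :: u) = χ u

/-- iterated invariance -/
def InvJ : ℕ → ∀ {κ : Type}, (List Γ → κ) → Prop
  | 0, _, χ => Inv0 χ
  | j + 1, _, χ => Inv0 χ ∧ ∀ a, InvJ j (fun u => χ (a :: u))

theorem InvJ.inv0 {κ : Type} {χ : List Γ → κ} {j : ℕ} (h : InvJ j χ) : Inv0 χ := by
  cases j with
  | zero => exact h
  | succ j => exact h.1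

theorem InvJ.post {κ κ' : Type} (φ : κ → κ') {j : ℕ} : ∀ {χ : List Γ → κ}, InvJ j χ →
    InvJ j (fun u => φ (χ u)) := by
  induction j with
  | zero => intro χ h a u hau; exact congrArg φ (h a u hau)
  | succ j ih =>
    intro χ h
    exact ⟨fun a u hau => congrArg φ (h.1 a u hau), fun a => ih (h.2 a)⟩

theorem Inv0.append {κ : Type} {χ : List Γ → κ} (h : Inv0 χ) (t v : List Γ)
    (ht : ∀ x ∈ t, x ∈ v) : χ (t ++ v) = χ v := by
  induction t with
  | nil => rfl
  | cons a t ih =>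
    rw [List.cons_append, h a (t ++ v) (by simp [ht a (by simp)])]
    exact ih fun x hx => ht x (by simp [hx])

theorem Inv0.nice_cons {κ : Type} {χ : List Γ → κ} (h : Inv0 χ) {w : List Γ → List Γ}
    (hw : Nice w) (a : Γ) (u : List Γ) : χ (w (a :: u)) = χ (a :: w u) := by
  obtain ⟨t, ht, hm⟩ := hw.cons a u
  rw [ht]
  apply h.append
  intro x hx
  have := hm x hx
  rw [List.mem_cons] at this ⊢
  rwa [hw.mem]

theorem exists_InvJ [Finite Γ] [Nonempty Γ] (j : ℕ) : ∀ {κ : Type} [Finite κ] (χ : List Γ → κ),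
    ∃ w, Nice w ∧ InvJ j (fun u => χ (w u)) := by
  induction j with
  | zero =>
    intro κ _ χ
    exact lemmaA χ
  | succ j ih =>
    intro κ _ χ
    obtain ⟨w0, hw0, h0⟩ := lemmaA χ
    obtain ⟨w1, hw1, h1⟩ := ih (fun u => fun a : Γ => χ (w0 (a :: u)))
    have h0' : Inv0 (fun u => χ (w0 u)) := h0
    refine ⟨fun u => w0 (w1 u), hw0.comp hw1, ?_, ?_⟩
    · intro a u hau
      have e := h0'.nice_cons hw1 a u
      simp only at e ⊢
      rw [e]
      exact h0 a (w1 u) ((hw1.mem u a).2 hau)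
    · intro a
      have := h1.post (fun φ => φ a)
      have e : (fun u => χ (w0 (w1 (a :: u)))) = fun u => χ (w0 (a :: w1 u)) := by
        funext u
        exact h0'.nice_cons hw1 a u
      rw [e]
      exact this

theorem InvJ.dedup [DecidableEq Γ] {κ : Type} (u : List Γ) : ∀ (j : ℕ) (χ : List Γ → κ),
    u.dedup.length ≤ j → InvJ j χ → χ u = χ u.dedup := by
  induction u with
  | nil => intro j χ _ _; rfl
  | cons a u ih =>
    intro j χ hj h
    by_cases hau : a ∈ u
    · rw [List.dedup_cons_of_mem hau] at hj ⊢
      rw [h.inv0 a u hau]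
      exact ih j χ hj h
    · rw [List.dedup_cons_of_notMem hau] at hj ⊢
      cases j with
      | zero => simp at hj
      | succ j => exact ih j (fun v => χ (a :: v)) (by simpa using hj) (h.2 a)

theorem ramsey_words [Fintype Γ] [DecidableEq Γ] [Nonempty Γ] {κ : Type} [Finite κ]
    (χ : List Γ → κ) : ∃ w, Nice w ∧ ∀ u, χ (w u) = χ (w u.dedup) := by
  obtain ⟨w, hw, h⟩ := exists_InvJ (Fintype.card Γ) χ
  exact ⟨w, hw, fun u => InvJ.dedup u _ _ (List.nodup_dedup u).length_le_card h⟩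

end Iterate

section Rat

/-- sequence chosen greedily -/
noncomputable def gseq (C : ℕ → ℕ → ℚ → ℚ → Prop) (n : ℕ) : ℚ :=
  Classical.epsilon (fun z => ∀ i : Fin n, C n i (gseq C i) z)
termination_by n
decreasing_by exact i.2

theorem exists_g (e : ℚ ≃ ℕ) (r : ℕ → ℚ) :
    ∃ g : ℕ → ℚ, (∀ i j, r i < r j → g i < g j) ∧ ∀ i j, i < j → e (g i) < e (g j) := by
  let C : ℕ → ℕ → ℚ → ℚ → Prop := fun n i gi z =>
    (r i < r n → gi < z) ∧ (r n < r i → z < gi) ∧ e gi < e z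
  have key : ∀ n, ∀ i < n, C n i (gseq C i) (gseq C n) := by
    intro n
    induction n using Nat.strong_induction_on with
    | _ n ih =>
      have hex : ∃ z, ∀ i : Fin n, C n i (gseq C i) z := by
        classical
        let lo := ((Finset.range n).filter (fun i => r i < r n)).image (gseq C)
        let hi := ((Finset.range n).filter (fun i => r n < r i)).image (gseq C)
        have hlh : ∀ x ∈ lo, ∀ y ∈ hi, x < y := by
          intro x hx y hy
          simp only [lo, hi, Finset.mem_image, Finset.mem_filter, Finset.mem_range] at hx hy
          obtain ⟨i, ⟨hi1, hi2⟩, rfl⟩ := hx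
          obtain ⟨j, ⟨hj1, hj2⟩, rfl⟩ := hy
          have hij := hi2.trans hj2
          rcases lt_trichotomy i j with h | h | h
          · exact (ih j hj1 i h).1 hij
          · subst h; exact absurd hij (lt_irrefl _)
          · exact (ih i hi1 j h).2.1 hij
        obtain ⟨m, hm1, hm2⟩ := Order.exists_between_finsets lo hi hlh
        obtain ⟨m', hm1', hm2'⟩ := Order.exists_between_finsets (insert m lo) hi (by
          intro x hx y hy
          rcases Finset.mem_insert.1 hx with rfl | hx
          · exact hm2 y hy
          · exact hlh x hx y hy)
        have hmm : m < m' := hm1' m (Finset.mem_insert_self _ _)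
        have hfin : Set.Finite {z : ℚ | ∃ i ∈ Finset.range n, e z ≤ e (gseq C i)} := by
          have : {z : ℚ | ∃ i ∈ Finset.range n, e z ≤ e (gseq C i)} =
              ⋃ i ∈ Finset.range n, e ⁻¹' Set.Iic (e (gseq C i)) := by
            ext z; simp
          rw [this]
          exact Set.Finite.biUnion (Finset.finite_toSet _)
            fun i _ => (Set.finite_Iic _).preimage e.injective.injOn
        obtain ⟨z, hz, hz2⟩ := (Set.Ioo_infinite hmm).exists_notMem_finite hfin
        refine ⟨z, fun i => ⟨fun h => ?_, fun h => ?_, ?_⟩⟩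
        · refine (hm1 _ ?_).trans hz.1
          simp only [lo, Finset.mem_image, Finset.mem_filter, Finset.mem_range]
          exact ⟨i, ⟨i.2, h⟩, rfl⟩
        · refine hz.2.trans (hm2' _ ?_)
          simp only [hi, Finset.mem_image, Finset.mem_filter, Finset.mem_range]
          exact ⟨i, ⟨i.2, h⟩, rfl⟩
        · by_contra hcon
          exact hz2 ⟨i, Finset.mem_range.2 i.2, not_lt.1 hcon⟩
      have := Classical.epsilon_spec hex
      rw [← gseq] at this
      exact fun i hi => this ⟨i, hi⟩
  refine ⟨gseq C, fun i j hij => ?_, fun i j hij => (key j i hij).2.2⟩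
  rcases lt_trichotomy i j with h | h | h
  · exact (key j i h).1 hij
  · subst h; exact absurd hij (lt_irrefl _)
  · exact (key i j h).2.1 hij

/-- dyadic value of a word -/
def rho : List Bool → ℚ
  | [] => 0
  | b :: l => ((if b then 1 else -1) + rho l) / 2

theorem rho_bound (l : List Bool) : -1 < rho l ∧ rho l < 1 := by
  induction l with
  | nil => simp [rho]
  | cons b l ih =>
    cases b <;> simp only [rho, if_true, Bool.false_eq_true, if_false] <;>
      constructor <;> linarith [ih.1, ih.2]

/-- numerical code -/
def code : List Bool → ℕ
  | [] => 1
  | b :: l => 2 * code l + (if b then 1 else 0)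

theorem code_bound (l : List Bool) : 2 ^ l.length ≤ code l ∧ code l < 2 ^ (l.length + 1) := by
  induction l with
  | nil => simp [code]
  | cons b l ih =>
    obtain ⟨h1, h2⟩ := ih
    simp only [code, List.length_cons]
    rw [pow_succ] at h2 ⊢
    rw [pow_succ, pow_succ]
    cases b <;> simp only [if_true, Bool.false_eq_true, if_false] <;> constructor <;> omega

theorem code_pos (l : List Bool) : 0 < code l := lt_of_lt_of_le (by positivity) (code_bound l).1

theorem code_inj : Function.Injective code := by
  intro s
  induction s with
  | nil =>
    intro t h
    cases t with
    | nil => rfl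
    | cons b t =>
      have := code_pos t
      simp only [code] at h
      omega
  | cons a s ih =>
    intro t h
    cases t with
    | nil =>
      have := code_pos s
      simp only [code] at h
      omega
    | cons b t =>
      simp only [code] at h
      have hst : code s = code t := by
        revert h
        cases a <;> cases b <;> simp only [if_true, Bool.false_eq_true, if_false] <;> omega
      have hab : a = b := by
        cases a <;> cases b <;> simp at h ⊢ <;> omega
      rw [hab, ih hst]

theorem exists_G (e : ℚ ≃ ℕ) : ∃ G : List Bool → ℚ, (∀ s t, rho s < rho t → G s < G t) ∧
    ∀ s t : List Bool, s.length < t.length → e (G s) < e (G t) := by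
  obtain ⟨g, h1, h2⟩ := exists_g e (fun n => rho (Function.invFun code n))
  refine ⟨fun s => g (code s), fun s t h => h1 _ _ ?_, fun s t h => h2 _ _ ?_⟩
  · rwa [Function.leftInverse_invFun code_inj, Function.leftInverse_invFun code_inj]
  · calc code s < 2 ^ (s.length + 1) := (code_bound s).2
      _ ≤ 2 ^ t.length := Nat.pow_le_pow_right (by norm_num) h
      _ ≤ code t := (code_bound t).1

/-- read a word up to the end marker -/
def dec : List (Option Bool) → List Bool
  | [] => []
  | none :: _ => []
  | some b :: l => b :: dec l

theorem dec_append_none (q t : List (Option Bool)) : dec (q ++ none :: t) = dec q := by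
  induction q with
  | nil => rfl
  | cons a q ih => cases a <;> simp [dec, ih]

theorem dec_length (q : List (Option Bool)) (h : none ∉ q) : (dec q).length = q.length := by
  induction q with
  | nil => rfl
  | cons a q ih =>
    cases a with
    | none => simp at h
    | some b => simp [dec, ih (fun hh => h (by simp [hh]))]

/-- value of a letter -/
def vl : Option Bool → ℚ
  | none => 0
  | some b => if b then 1 else -1

theorem rho_dec_lt (q : List (Option Bool)) (hq : none ∉ q) (d d' : Option Bool) (h : vl d < vl d')
    (t t' : List (Option Bool)) : rho (dec (q ++ d :: t)) < rho (dec (q ++ d' :: t')) := by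
  induction q with
  | nil =>
    have b1 := rho_bound (dec t)
    have b2 := rho_bound (dec t')
    rcases d with _ | _ | _ <;> rcases d' with _ | _ | _ <;>
      simp [vl, dec, rho] at h ⊢ <;> linarith [b1.1, b1.2, b2.1, b2.2]
  | cons a q ih =>
    cases a with
    | none => simp at hq
    | some b =>
      have := ih (fun hh => hq (by simp [hh]))
      simp only [List.cons_append, dec, rho]
      linarith

end Rat

section Final

/-- the letter at position `i` of the branch coding the `n`-th rational -/
noncomputable def cD (e : ℚ ≃ ℕ) (n i : ℕ) : Option Bool :=
  if i < n then some (decide (e.symm i < e.symm n)) else none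

variable {A : Type}

noncomputable def DD (A : Type) (e : ℚ ≃ ℕ) (n i : ℕ) : Option A → Option Bool := fun _ => cD e n i

/-- decode a coordinate of a word -/
def dc (a : Option A) (u : List (Option A → Option Bool)) : List Bool :=
  dec ((u.map (fun γ => γ a)).reverse)

theorem dc_ext {w : List (Option A → Option Bool) → List (Option A → Option Bool)} (hw : Nice w)
    (e : ℚ ≃ ℕ) {n N : ℕ} (h : n < N) :
    dc none (w (RR (DD A e n) N)) = dc none (w (RR (DD A e n) n)) := by
  obtain ⟨l, hl⟩ := RR_split (DD A e n) h
  obtain ⟨t, ht, -⟩ := hw.split l (DD A e n n) (RR (DD A e n) n)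
  rw [hl, ht]
  have : DD A e n n none = none := by simp [DD, cD]
  simp only [dc, List.map_append, List.map_cons, this, List.reverse_append, List.reverse_cons,
    List.append_assoc, List.singleton_append, dec_append_none]

theorem none_notMem {w : List (Option A → Option Bool) → List (Option A → Option Bool)}
    (hw : Nice w) (e : ℚ ≃ ℕ) {n i : ℕ} (h : i ≤ n) :
    none ∉ ((w (RR (DD A e n) i)).map (fun γ => γ none)).reverse := by
  intro hm
  rw [List.mem_reverse, List.mem_map] at hm
  obtain ⟨γ, hγ, h0⟩ := hm
  rw [hw.mem, mem_RR] at hγ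
  obtain ⟨j, hj, rfl⟩ := hγ
  have : j < n := by omega
  simp [DD, cD, this] at h0

theorem rho_lt_of {w : List (Option A → Option Bool) → List (Option A → Option Bool)}
    (hw : Nice w) (e : ℚ ≃ ℕ) {n m : ℕ} (h : e.symm n < e.symm m) :
    rho (dc none (w (RR (DD A e n) n))) < rho (dc none (w (RR (DD A e m) m))) := by
  classical
  have hne : n ≠ m := by rintro rfl; exact lt_irrefl _ h
  have hex : ∃ i, cD e n i ≠ cD e m i := by
    rcases lt_or_gt_of_ne hne with h' | h'
    · exact ⟨n, by simp [cD, h']⟩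
    · exact ⟨m, by simp [cD, h']⟩
  obtain ⟨i, hi, hmin⟩ : ∃ i, cD e n i ≠ cD e m i ∧ ∀ j < i, cD e n j = cD e m j :=
    ⟨Nat.find hex, Nat.find_spec hex, fun j hj => not_not.1 (Nat.find_min hex hj)⟩
  have hin : i ≤ n := by
    by_contra hc
    push Not at hc
    have h3 := hmin n hc
    rcases lt_or_gt_of_ne hne with h' | h'
    · simp [cD, h'] at h3
    · have h4 := hmin m (by omega)
      simp [cD, h'] at h4
  have him : i ≤ m := by
    by_contra hc
    push Not at hc
    have h3 := hmin m hc
    rcases lt_or_gt_of_ne hne with h' | h'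
    · have h4 := hmin n (by omega)
      simp [cD, h'] at h4
    · simp [cD, h'] at h3
  have hv : vl (cD e n i) < vl (cD e m i) := by
    rcases hin.lt_or_eq with h1 | h1
    · rcases him.lt_or_eq with h2 | h2
      · simp only [cD, h1, h2, if_true] at hi ⊢
        by_cases h3 : e.symm i < e.symm n
        · have h4 : e.symm i < e.symm m := h3.trans h
          simp [h3, h4] at hi
        · by_cases h4 : e.symm i < e.symm m
          · simp [h3, h4, vl]
          · simp [h3, h4] at hi
      · subst h2
        simp [cD, h1, vl, not_lt.2 h.le]
    · subst h1
      have h2 : i < m := by omega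
      simp [cD, h2, vl, h]
  have hp : RR (DD A e n) i = RR (DD A e m) i :=
    RR_congr (fun j hj => by funext _; exact hmin j hj)
  rw [← dc_ext hw e (show n < n + 1 by omega), ← dc_ext hw e (show m < m + 1 by omega)]
  obtain ⟨l, hl⟩ := RR_split (DD A e n) (show i < n + 1 by omega)
  obtain ⟨t, ht, -⟩ := hw.split l (DD A e n i) (RR (DD A e n) i)
  obtain ⟨l', hl'⟩ := RR_split (DD A e m) (show i < m + 1 by omega)
  obtain ⟨t', ht', -⟩ := hw.split l' (DD A e m i) (RR (DD A e m) i)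
  rw [hl, ht, hl', ht', ← hp]
  simp only [dc, List.map_append, List.map_cons, List.reverse_append, List.reverse_cons,
    List.append_assoc, List.singleton_append]
  exact rho_dec_lt _ (none_notMem hw e hin) _ _ hv _ _

theorem dc_length {w : List (Option A → Option Bool) → List (Option A → Option Bool)}
    (hw : Nice w) (e : ℚ ≃ ℕ) (n : ℕ) :
    (dc none (w (RR (DD A e n) n))).length = (w (RR (DD A e 0) n)).length := by
  rw [dc, dec_length _ (none_notMem hw e le_rfl), List.length_reverse, List.length_map]
  have h1 := congrArg List.length (hw.nat (fun _ _ => none) (RR (DD A e n) n))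
  have h2 := congrArg List.length (hw.nat (fun _ _ => none) (RR (DD A e 0) n))
  rw [List.length_map, RR_map] at h1 h2
  rw [← h1, ← h2]

theorem length_lt_of {w : List (Option A → Option Bool) → List (Option A → Option Bool)}
    (hw : Nice w) (e : ℚ ≃ ℕ) {n m : ℕ} (h : n < m) :
    (dc none (w (RR (DD A e n) n))).length < (dc none (w (RR (DD A e m) m))).length := by
  rw [dc_length hw, dc_length hw]
  obtain ⟨l, hl⟩ := RR_split (DD A e 0) h
  obtain ⟨t, ht, -⟩ := hw.split l (DD A e 0 n) (RR (DD A e 0) n)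
  rw [hl, ht]
  simp only [List.length_append, List.length_cons]
  omega

theorem dc_col {w : List (Option A → Option Bool) → List (Option A → Option Bool)}
    (hw : Nice w) (e : ℚ ≃ ℕ) (f : A → ℚ) (N : ℕ) (a : A) (h : e (f a) < N) :
    dc (some a) (w (RR (fun i oa => oa.elim none (fun a => cD e (e (f a)) i)) N)) =
      dc none (w (RR (DD A e (e (f a))) (e (f a)))) := by
  rw [← dc_ext hw e h]
  have h1 := hw.nat (fun γ _ => γ (some a))
    (RR (fun i oa => oa.elim none (fun a => cD e (e (f a)) i)) N)
  rw [RR_map] at h1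
  have h2 : (fun j => (fun (γ : Option A → Option Bool) (_ : Option A) => γ (some a))
      ((fun i oa => oa.elim none (fun a => cD e (e (f a)) i)) j)) = DD A e (e (f a)) := by
    funext j oa
    simp [DD]
  rw [h2] at h1
  rw [h1]
  simp only [dc, List.map_map]
  rfl

end Final

theorem stmt8
    -- `⊏` is a linear order on `ℚ` of order type `ω`
    (lt2 : ℚ → ℚ → Prop) (hlt2 : IsStrictTotalOrder ℚ lt2)
    (homega : ∃ e : ℚ ≃ ℕ, ∀ x y : ℚ, lt2 x y ↔ e x < e y)
    -- a finite permutation `(A, ra₁, ra₂)`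
    (A : Type) (hAfin : Finite A) (ra₁ ra₂ : A → A → Prop)
    (h₁ : IsStrictTotalOrder A ra₁) (h₂ : IsStrictTotalOrder A ra₂) :
    ∃ T : ℕ, 0 < T ∧ ∀ k, 2 ≤ k →
      ∀ χ : {f : A → ℚ // PermEmb ra₁ ra₂ (· < ·) lt2 f} → Fin k,
        ∃ w : {g : ℚ → ℚ // PermEmb (· < ·) lt2 (· < ·) lt2 g},
          (χ '' {p | ∃ f₀ : {f : A → ℚ // PermEmb ra₁ ra₂ (· < ·) lt2 f},
            p.val = w.val ∘ f₀.val}).ncard ≤ T := by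
  classical
  obtain ⟨e, he⟩ := homega
  have := Fintype.ofFinite A
  obtain ⟨G, hG1, hG2⟩ := exists_G e
  refine ⟨Nat.card {l : List (Option A → Option Bool) // l.Nodup} + 1, by omega, ?_⟩
  intro k hk χ
  let χ' : List (Option A → Option Bool) → Fin k := fun u =>
    if h : PermEmb ra₁ ra₂ (· < ·) lt2 (fun a => G (dc (some a) u)) then χ ⟨_, h⟩
    else ⟨0, by omega⟩
  obtain ⟨w, hw, hχ⟩ := ramsey_words χ'
  let W : ℚ → ℚ := fun x => G (dc none (w (RR (DD A e (e x)) (e x))))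
  have hW1 : ∀ x y, x < y → W x < W y := fun x y h =>
    hG1 _ _ (rho_lt_of hw e (by simpa using h))
  have hW2 : ∀ x y, lt2 x y → lt2 (W x) (W y) := fun x y h =>
    (he _ _).2 (hG2 _ _ (length_lt_of hw e ((he x y).1 h)))
  have hWi : Function.Injective W := (show StrictMono W from fun x y h => hW1 x y h).injective
  refine ⟨⟨W, hWi, hW1, hW2⟩, ?_⟩
  have hsub : (χ '' {p | ∃ f₀ : {f : A → ℚ // PermEmb ra₁ ra₂ (· < ·) lt2 f},
      p.val = W ∘ f₀.val}) ⊆ Set.range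
        (fun l : {l : List (Option A → Option Bool) // l.Nodup} => χ' (w l.1)) := by
    rintro _ ⟨p, ⟨f₀, hp⟩, rfl⟩
    obtain ⟨N, hN⟩ : ∃ N, ∀ a, e (f₀.1 a) < N := by
      obtain ⟨M, hM⟩ := (Set.finite_range (fun a => e (f₀.1 a))).bddAbove
      exact ⟨M + 1, fun a => Nat.lt_succ_of_le (hM ⟨a, rfl⟩)⟩
    let u : List (Option A → Option Bool) :=
      RR (fun i oa => oa.elim none (fun a => cD e (e (f₀.1 a)) i)) N
    have hf : (fun a => G (dc (some a) (w u))) = p.1 := by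
      rw [hp]
      funext a
      exact congrArg G (dc_col hw e f₀.1 N a (hN a))
    refine ⟨⟨u.dedup, u.nodup_dedup⟩, ?_⟩
    show χ' (w u.dedup) = χ p
    rw [← hχ u]
    have hP : PermEmb ra₁ ra₂ (· < ·) lt2 (fun a => G (dc (some a) (w u))) := by
      rw [hf]; exact p.2
    show (if h : PermEmb ra₁ ra₂ (· < ·) lt2 (fun a => G (dc (some a) (w u))) then χ ⟨_, h⟩
      else ⟨0, by omega⟩) = χ p
    rw [dif_pos hP]
    exact congrArg χ (Subtype.ext hf)
  have hfin : (Set.range (fun l : {l : List (Option A → Option Bool) // l.Nodup} =>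
      χ' (w l.1))).Finite := Set.toFinite _
  have hF : Finite {l : List (Option A → Option Bool) // l.Nodup} := inferInstance
  refine (Set.ncard_le_ncard hsub hfin).trans ?_
  rw [← Nat.card_coe_set_eq]
  exact (Finite.card_range_le _).trans (Nat.le_succ _)
end

section
/- Let R = (R, E) be a countable graph with the extension property: for all finite disjoint sets U, V of vertices of R there is a vertex adjacent to every vertex of U and to no vertex of V (such a graph is the random graph). Let ⊏ be a linear order on the vertex set of R of order type ω. Then every finite linearly ordered graph (A, E^A, ≺) has finite big Ramsey degree in (R, E, ⊏): there exists a positive integer T such that for every k ≥ 2 and every coloring χ of the set of embeddings of (A, E^A, ≺) into (R, E, ⊏) with k colors there is an embedding w of (R, E, ⊏) into itself such that {χ(w ∘ f) : f an embedding of (A, E^A, ≺) into (R, E, ⊏)} has at most T elements. -/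
/-- An embedding of linearly ordered graphs: an injective map that preserves and
reflects the edge relation and is strictly increasing with respect to the
linear orders. -/
def LOGraphEmb {A B : Type} (adjA : A → A → Prop) (ra : A → A → Prop)
    (adjB : B → B → Prop) (rb : B → B → Prop) (f : A → B) : Prop :=
  Function.Injective f ∧ (∀ x y, adjA x y ↔ adjB (f x) (f y)) ∧
    (∀ x y, ra x y → rb (f x) (f y))


/-- rigid surjections of `ℕ` fixing `[0,n)` pointwise -/
def RS (n : ℕ) (f : ℕ → ℕ) : Prop :=
  (∀ i < n, f i = i) ∧ (∀ i, ∀ v < f i, ∃ j < i, f j = v) ∧ (∀ v, ∃ i, f i = v)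

/-- `c U` depends only on `U` up to the first occurrence of `N` -/
def Dep {κ : Type} (n N : ℕ) (c : (ℕ → ℕ) → κ) : Prop :=
  ∀ U U' : ℕ → ℕ, RS n U → RS n U' → ∀ l, U l = N → (∀ i < l, U i < N) →
    (∀ i ≤ l, U' i = U i) → c U = c U'

lemma RS.id (n : ℕ) : RS n id :=
  ⟨fun _ _ => rfl, fun _ v hv => ⟨v, hv, rfl⟩, fun v => ⟨v, rfl⟩⟩

lemma RS.mono {n m : ℕ} (h : n ≤ m) {f : ℕ → ℕ} (hf : RS m f) : RS n f :=
  ⟨fun i hi => hf.1 i (by omega), hf.2.1, hf.2.2⟩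

lemma RS.comp {n : ℕ} {f g : ℕ → ℕ} (hf : RS n f) (hg : RS n g) : RS n (f ∘ g) := by
  refine ⟨fun i hi => ?_, fun i v hv => ?_, fun v => ?_⟩
  · simp [hg.1 i hi, hf.1 i hi]
  · obtain ⟨j, hj, rfl⟩ := hf.2.1 _ _ hv
    obtain ⟨k, hk, rfl⟩ := hg.2.1 _ _ hj
    exact ⟨k, hk, rfl⟩
  · obtain ⟨j, rfl⟩ := hf.2.2 v
    obtain ⟨k, rfl⟩ := hg.2.2 j
    exact ⟨k, rfl⟩

lemma RS.le {n : ℕ} {f : ℕ → ℕ} (hf : RS n f) (i : ℕ) : f i ≤ i := by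
  induction i using Nat.strong_induction_on with
  | _ i ih =>
    by_contra h
    push Not at h
    obtain ⟨j, hj, hji⟩ := hf.2.1 i i h
    have := ih j hj
    omega

/-- first occurrence of `v` -/
lemma RS.first {n : ℕ} {f : ℕ → ℕ} (hf : RS n f) (v : ℕ) :
    ∃ i, f i = v ∧ ∀ j < i, f j < v := by
  classical
  refine ⟨Nat.find (hf.2.2 v), Nat.find_spec (hf.2.2 v), fun j hj => ?_⟩
  by_contra h
  push Not at h
  rcases h.eq_or_lt with h | h
  · exact Nat.find_min (hf.2.2 v) hj h.symm
  · obtain ⟨k, hk, hkv⟩ := hf.2.1 j v h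
    exact Nat.find_min (hf.2.2 v) (hk.trans hj) hkv

lemma Dep.comp {κ : Type} {n N : ℕ} {c : (ℕ → ℕ) → κ} (hc : Dep n N c) {h : ℕ → ℕ}
    (hh : RS n h) {n' : ℕ} (hn : n ≤ n') : Dep n' N (fun U => c (U ∘ h)) := by
  intro U U' hU hU' l hl hlt heq
  obtain ⟨i, hi, hi'⟩ := hh.first l
  refine hc _ _ ((hU.mono hn).comp hh) ((hU'.mono hn).comp hh) i (by simp [hi, hl]) ?_ ?_
  · intro j hj
    exact hlt _ (hi' j hj)
  · intro j hj
    refine heq _ ?_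
    rcases hj.eq_or_lt with rfl | hj
    · exact hi.le
    · exact (hi' j hj).le

/-- replace the prefix of length `m` -/
def tau (n m : ℕ) (u : Fin m → Fin n) (i : ℕ) : ℕ :=
  if h : i < m then u ⟨i, h⟩ else i - m + n

/-- lift of a rigid surjection -/
def liftRS (n m : ℕ) (g : ℕ → ℕ) (i : ℕ) : ℕ :=
  if i ≤ m then i else if g (i - m + n) < n then g (i - m + n) else g (i - m + n) - n + m

lemma liftRS_RS {n m : ℕ} (hnm : n ≤ m) {g : ℕ → ℕ} (hg : RS (n + 1) g) :
    RS (m + 1) (liftRS n m g) := by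
  have hfix : ∀ i ≤ m, liftRS n m g i = i := fun i hi => by simp [liftRS, hi]
  have hbig : ∀ j v, n < v → g j = v → n < j ∧ liftRS n m g (j - n + m) = v - n + m := by
    intro j v hv hj
    have h1 : n < j := by
      by_contra h
      have := hg.1 j (by omega)
      omega
    refine ⟨h1, ?_⟩
    have h2 : j - n + m - m + n = j := by omega
    have h3 : ¬ (j - n + m ≤ m) := by omega
    simp only [liftRS, h2, h3, if_false, hj]
    rw [if_neg (by omega)]
  refine ⟨fun i hi => hfix i (by omega), fun i v hv => ?_, fun v => ?_⟩
  · by_cases him : i ≤ m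
    · rw [hfix i him] at hv
      exact ⟨v, hv, hfix v (by omega)⟩
    · by_cases hvm : v ≤ m
      · exact ⟨v, by omega, hfix v hvm⟩
      · have hv' : v - m + n < g (i - m + n) := by
          simp only [liftRS, him, if_false] at hv
          split_ifs at hv <;> omega
        obtain ⟨j, hj, hjv⟩ := hg.2.1 _ _ hv'
        obtain ⟨h1, h2⟩ := hbig j _ (by omega) hjv
        exact ⟨j - n + m, by omega, by rw [h2]; omega⟩
  · by_cases hvm : v ≤ m
    · exact ⟨v, hfix v hvm⟩
    · obtain ⟨j, hj⟩ := hg.2.2 (v - m + n)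
      obtain ⟨h1, h2⟩ := hbig j _ (by omega) hj
      exact ⟨_, by rw [h2]; omega⟩

lemma tau_lift {n m : ℕ} (hnm : n ≤ m) {g : ℕ → ℕ} (hg : RS (n + 1) g) {u : Fin m → Fin n}
    (hu : RS n (tau n m u)) : tau n m u ∘ liftRS n m g = g ∘ tau n m u := by
  funext i
  simp only [Function.comp]
  by_cases him : i < m
  · have h1 : liftRS n m g i = i := by simp [liftRS, him.le]
    have h2 : tau n m u i < n := by simp [tau, him]
    rw [h1, hg.1 _ (by omega)]
  · have h2 : tau n m u i = i - m + n := by simp [tau, him]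
    rw [h2]
    by_cases hi : i = m
    · subst hi
      have : liftRS n i g i = i := by simp [liftRS]
      rw [this, h2, hg.1 _ (by omega)]
    · have h3 : ¬ i ≤ m := by omega
      simp only [liftRS, h3, if_false]
      split_ifs with h4
      · exact hu.1 _ h4
      · rw [tau, dif_neg (by omega)]
        omega

lemma factor {n m : ℕ} {V : ℕ → ℕ} (hV : RS n V) (hm : V m = n) {u : Fin m → Fin n}
    (hu : ∀ i : Fin m, V i = u i) :
    n ≤ m ∧ RS n (tau n m u) ∧ ∃ U, RS (n + 1) U ∧ V = U ∘ tau n m u := by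
  have hnm : n ≤ m := by
    by_contra h
    have := hV.1 m (by omega)
    omega
  have hlt : ∀ i < m, V i < n := fun i hi => by
    have := hu ⟨i, hi⟩
    simp only at this
    omega
  refine ⟨hnm, ⟨fun i hi => ?_, fun i v hv => ?_, fun v => ?_⟩,
    fun i => if i ≤ n then i else V (i - n + m), ⟨fun i hi => ?_, fun i v hv => ?_, fun v => ?_⟩, ?_⟩
  · have := hu ⟨i, by omega⟩
    simp only at this
    rw [tau, dif_pos (by omega), ← this, hV.1 i hi]
  · by_cases hi : i < m
    · have h1 := hu ⟨i, hi⟩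
      simp only at h1
      rw [tau, dif_pos hi, ← h1] at hv
      obtain ⟨j, hj, hjv⟩ := hV.2.1 _ _ hv
      refine ⟨j, hj, ?_⟩
      have h2 := hu ⟨j, by omega⟩
      simp only at h2
      rw [tau, dif_pos (by omega), ← h2, hjv]
    · rw [tau, dif_neg hi] at hv
      by_cases hvn : v < n
      · have h2 := hu ⟨v, by omega⟩
        simp only at h2
        exact ⟨v, by omega, by rw [tau, dif_pos (by omega), ← h2, hV.1 v hvn]⟩
      · exact ⟨v - n + m, by omega, by rw [tau, dif_neg (by omega)]; omega⟩
  · by_cases hvn : v < n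
    · have h2 := hu ⟨v, by omega⟩
      simp only at h2
      exact ⟨v, by rw [tau, dif_pos (by omega), ← h2, hV.1 v hvn]⟩
    · exact ⟨v - n + m, by rw [tau, dif_neg (by omega)]; omega⟩
  · simp only; rw [if_pos (by omega)]
  · simp only at hv ⊢
    by_cases hin : i ≤ n
    · rw [if_pos hin] at hv
      exact ⟨v, hv, by rw [if_pos (by omega)]⟩
    · rw [if_neg hin] at hv
      by_cases hvn : v ≤ n
      · exact ⟨v, by omega, by rw [if_pos hvn]⟩
      · obtain ⟨j, hj, hjv⟩ := hV.2.1 _ _ hv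
        have : m < j := by
          by_contra h
          rcases (not_lt.mp h).eq_or_lt with h | h
          · subst h; omega
          · have := hlt j h; omega
        refine ⟨j - m + n, by omega, ?_⟩
        rw [if_neg (by omega), ← hjv]
        congr 1; omega
  · simp only
    by_cases hvn : v ≤ n
    · exact ⟨v, by rw [if_pos hvn]⟩
    · obtain ⟨j, hjv⟩ := hV.2.2 v
      have : m < j := by
        by_contra h
        rcases (not_lt.mp h).eq_or_lt with h | h
        · subst h; omega
        · have := hlt j h; omega
      refine ⟨j - m + n, ?_⟩
      rw [if_neg (by omega), ← hjv]
      congr 1; omega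
  · funext i
    simp only [Function.comp]
    by_cases hi : i < m
    · have h1 := hu ⟨i, hi⟩
      simp only at h1
      have h2 := hlt i hi
      rw [tau, dif_pos hi, ← h1, if_pos h2.le]
    · rw [tau, dif_neg hi]
      by_cases him : i = m
      · subst him
        rw [if_pos (by omega), hm]; omega
      · rw [if_neg (by omega)]
        congr 1; omega

/-- the statement of the `k`-dimensional Carlson Simpson theorem over the alphabet `[0,n)` -/
def CS (n k : ℕ) : Prop :=
  ∀ (κ : Type) (_ : Finite κ) (c : (ℕ → ℕ) → κ), Dep n (n + k) c →
    ∃ f, RS n f ∧ ∀ U, RS n U → c (U ∘ f) = c f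

lemma fusion_step {n k : ℕ} (h : CS (n + 1) k) {κ : Type} [Finite κ] {c : (ℕ → ℕ) → κ}
    (hc : Dep n (n + (k + 1)) c) (m : ℕ) (hnm : n ≤ m) {F : ℕ → ℕ} (hF : RS n F) :
    ∃ g, RS (m + 1) g ∧ ∀ U U', RS n U → RS n U' → U m = n → (∀ i < m, U i < n) →
      (∀ i ≤ m, U' i = U i) → c (U ∘ g ∘ F) = c (U' ∘ g ∘ F) := by
  obtain ⟨g, hg, hgU⟩ := h ({u : Fin m → Fin n // RS n (tau n m u)} → κ) inferInstance
    (fun U u => c (U ∘ tau n m u.1 ∘ F)) (by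
      intro U U' hU hU' l hl hlt heq
      funext u
      refine (hc.comp (u.2.comp hF) (Nat.le_succ n)) U U' hU hU' l ?_ ?_ heq
      · omega
      · intro i hi
        have := hlt i hi
        omega)
  refine ⟨liftRS n m g, liftRS_RS hnm hg, ?_⟩
  have key : ∀ U, RS n U → U m = n → ∀ u : Fin m → Fin n, (∀ i : Fin m, U i = u i) →
      ∀ hu : RS n (tau n m u), c (U ∘ liftRS n m g ∘ F) = c (g ∘ tau n m u ∘ F) := by
    intro U hU hUm u hUu hu
    obtain ⟨-, -, W, hW, rfl⟩ := factor hU hUm hUu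
    have h1 := congrFun (hgU W hW) ⟨u, hu⟩
    simp only at h1
    rw [← h1]
    congr 1
    have := tau_lift hnm hg hu
    calc (W ∘ tau n m u) ∘ liftRS n m g ∘ F = W ∘ (tau n m u ∘ liftRS n m g) ∘ F := rfl
      _ = _ := by rw [this]; rfl
  intro U U' hU hU' hm hlt heq
  let u : Fin m → Fin n := fun i => ⟨U i, hlt i i.2⟩
  have hu := (factor hU hm (u := u) (fun i => rfl)).2.1
  rw [key U hU hm u (fun i => rfl) hu, key U' hU' (by rw [heq m le_rfl, hm]) u
    (fun i => by rw [heq i i.2.le]) hu]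

lemma fusion {n k : ℕ} (h : CS (n + 1) k) {κ : Type} [Finite κ] {c : (ℕ → ℕ) → κ}
    (hc : Dep n (n + (k + 1)) c) : ∃ F, RS n F ∧ Dep n n (fun U => c (U ∘ F)) := by
  have hstep := fun m (hnm : n ≤ m) (F : {F : ℕ → ℕ // RS n F}) =>
    fusion_step h hc m hnm F.2
  choose g hg hgc using hstep
  let f : ℕ → {F : ℕ → ℕ // RS n F} := fun t => Nat.rec ⟨id, RS.id n⟩
    (fun t F => ⟨g (n + t) (by omega) F ∘ F.1, ((hg (n + t) (by omega) F).mono (by omega)).comp F.2⟩) t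
  have hf : ∀ t, (f (t + 1)).1 = g (n + t) (by omega) (f t) ∘ (f t).1 := fun t => rfl
  have hfac : ∀ t s, ∃ H, RS (n + t) H ∧ (f (t + s)).1 = H ∘ (f t).1 := by
    intro t s
    induction s with
    | zero => exact ⟨id, RS.id _, rfl⟩
    | succ s ih =>
      obtain ⟨H, hH, hHf⟩ := ih
      refine ⟨g (n + (t + s)) (by omega) (f (t + s)) ∘ H,
        ((hg _ _ _).mono (by omega)).comp hH, ?_⟩
      rw [← add_assoc, hf, hHf]; rfl
  have hstab : ∀ t s i, (f t).1 i < n + t → (f (t + s)).1 i = (f t).1 i := by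
    intro t s i hi
    obtain ⟨H, hH, hHf⟩ := hfac t s
    rw [hHf]
    exact hH.1 _ hi
  let F : ℕ → ℕ := fun i => (f (i + 1)).1 i
  have hFs : ∀ s i, i < s → F i = (f s).1 i := by
    intro s i hi
    obtain ⟨r, rfl⟩ := Nat.exists_eq_add_of_le (Nat.succ_le_of_lt hi)
    exact (hstab (i + 1) r i (by have := (f (i + 1)).2.le i; omega)).symm
  have hF : RS n F := by
    refine ⟨fun i hi => (f (i + 1)).2.1 i hi, fun i v hv => ?_, fun v => ?_⟩
    · obtain ⟨j, hj, hjv⟩ := (f (i + 1)).2.2.1 i v hv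
      exact ⟨j, hj, by rw [hFs (i + 1) j (by omega), hjv]⟩
    · obtain ⟨i, hi⟩ := (f (v + 1)).2.2.2 v
      refine ⟨i, ?_⟩
      rw [hFs (v + 1 + (i + 1)) i (by omega), hstab (v + 1) (i + 1) i (by omega), hi]
  refine ⟨F, hF, ?_⟩
  -- finite approximation
  have happ : ∀ U, RS n U → ∃ s0, ∀ s ≥ s0, c (U ∘ F) = c (U ∘ (f s).1) := by
    intro U hU
    obtain ⟨l, hl, hl'⟩ := (hU.comp hF).first (n + (k + 1))
    refine ⟨l + 1, fun s hs => hc _ _ (hU.comp hF) (hU.comp (f s).2) l hl hl' ?_⟩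
    intro i hi
    simp only [Function.comp]
    rw [hFs s i (by omega)]
  intro U U' hU hU' m hm hlt heq
  have hnm : n ≤ m := by
    by_contra h
    have := hU.1 m (by omega)
    omega
  obtain ⟨t, rfl⟩ := Nat.exists_eq_add_of_le hnm
  obtain ⟨s0, hs0⟩ := happ U hU
  obtain ⟨s1, hs1⟩ := happ U' hU'
  simp only
  rw [hs0 (t + 1 + (s0 + s1)) (by omega), hs1 (t + 1 + (s0 + s1)) (by omega)]
  obtain ⟨H, hH, hHf⟩ := hfac (t + 1) (s0 + s1)
  rw [hHf, hf]
  have hH' := hH.mono (show n ≤ n + (t + 1) by omega)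
  refine hgc (n + t) (by omega) (f t) (U ∘ H) (U' ∘ H) (hU.comp hH') (hU'.comp hH') ?_ ?_ ?_
  · simp only [Function.comp]; rw [hH.1 _ (by omega), hm]
  · intro i hi
    simp only [Function.comp]; rw [hH.1 _ (by omega)]; exact hlt i hi
  · intro i hi
    simp only [Function.comp]; rw [hH.1 _ (by omega)]; exact heq i hi

lemma CS_all (h0 : ∀ n, CS n 0) : ∀ k n, CS n k := by
  intro k
  induction k with
  | zero => exact h0
  | succ k ih =>
    intro n κ hκ c hc
    obtain ⟨F, hF, hFc⟩ := fusion (ih (n + 1)) hc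
    obtain ⟨g, hg, hgc⟩ := h0 n κ hκ _ hFc
    exact ⟨g ∘ F, hg.comp hF, fun U hU => hgc U hU⟩

section UltrafilterPart
open Filter
attribute [local instance] Ultrafilter.mul Ultrafilter.semigroup

lemma ultrafilter_map_mul {M N : Type} [Monoid M] [Monoid N] (f : M →* N) (U V : Ultrafilter M) :
    Ultrafilter.map f (U * V) = Ultrafilter.map f U * Ultrafilter.map f V := by
  refine Ultrafilter.coe_inj.mp (Filter.ext' fun p => ?_)
  simp only [Ultrafilter.eventually_mul, Ultrafilter.coe_map, Filter.eventually_map, map_mul]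

lemma ultrafilter_continuous_map {M N : Type} (f : M → N) :
    Continuous (Ultrafilter.map f : Ultrafilter M → Ultrafilter N) :=
  ultrafilterBasis_is_basis.continuous_iff.2 <| Set.forall_mem_range.mpr fun s ↦
    ultrafilter_isOpen_basic (f ⁻¹' s)

/-- existence of minimal closed left ideals -/
lemma exists_min_left_ideal (M : Type) [Monoid M] :
    ∃ L : Set (Ultrafilter M), IsClosed L ∧ L.Nonempty ∧ (∀ p, ∀ q ∈ L, p * q ∈ L) ∧
      ∀ p ∈ L, ∀ q ∈ L, ∃ r, p = r * q := by
  let S : Set (Set (Ultrafilter M)) :=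
    { N | IsClosed N ∧ N.Nonempty ∧ ∀ p, ∀ q ∈ N, p * q ∈ N }
  obtain ⟨L, hL⟩ : ∃ N', Minimal (· ∈ S) N' := by
    refine zorn_superset _ fun c hcs hc => ?_
    refine
      ⟨⋂₀ c, ⟨isClosed_sInter fun t ht => (hcs ht).1, ?_, fun m m' hm' => ?_⟩, fun s hs =>
        Set.sInter_subset_of_mem hs⟩
    · obtain rfl | hcnemp := c.eq_empty_or_nonempty
      · rw [Set.sInter_empty]
        exact ⟨pure 1, trivial⟩
      convert!
        @IsCompact.nonempty_iInter_of_directed_nonempty_isCompact_isClosed _ _ _ hcnemp.coe_sort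
          ((↑) : c → Set (Ultrafilter M)) ?_ ?_ ?_ ?_
      · exact Set.sInter_eq_iInter
      · refine DirectedOn.directed_val (IsChain.directedOn hc.symm)
      exacts [fun i => (hcs i.prop).2.1, fun i => (hcs i.prop).1.isCompact,
        fun i => (hcs i.prop).1]
    · rw [Set.mem_sInter]
      exact fun t ht => (hcs ht).2.2 m m' (Set.mem_sInter.mp hm' t ht)
  obtain ⟨hc, hne, hid⟩ := hL.prop
  refine ⟨L, hc, hne, hid, fun p hp q hq => ?_⟩
  have : (· * q) '' Set.univ = L := by
    apply hL.eq_of_subset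
    · refine ⟨(Ultrafilter.continuous_mul_left q).isClosedMap _ isClosed_univ,
        ⟨_, ⟨q, trivial, rfl⟩⟩, ?_⟩
      rintro r _ ⟨s, -, rfl⟩
      exact ⟨r * s, trivial, mul_assoc _ _ _⟩
    · rintro _ ⟨m', -, rfl⟩
      exact hid _ _ hq
  rw [← this] at hp
  obtain ⟨r, -, hr⟩ := hp
  exact ⟨r, hr.symm⟩

/-- substitution of a letter for the variable -/
def subL {A : Type} (a : A) : FreeMonoid (Option A) →* FreeMonoid A :=
  FreeMonoid.map (fun o => o.getD a)

lemma exists_good_ultrafilter (A : Type) :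
    ∃ V : Ultrafilter (FreeMonoid (Option A)),
      (∀ᶠ x : FreeMonoid (Option A) in V, ∃ y, x = FreeMonoid.of none * y) ∧
      ∀ a b, Ultrafilter.map (subL a) V * Ultrafilter.map (subL b) V
        = Ultrafilter.map (subL a) V := by
  obtain ⟨L, hLc, ⟨q, hq⟩, hLi, hLm⟩ := exists_min_left_ideal (FreeMonoid A)
  let B : Set (FreeMonoid (Option A)) := {x | ∃ y, x = FreeMonoid.of none * y}
  let J : Set (Ultrafilter (FreeMonoid (Option A))) :=
    {V | B ∈ V} ∩ ⋂ a : A, (Ultrafilter.map (subL a)) ⁻¹' L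
  have hJc : IsClosed J :=
    (ultrafilter_isClosed_basic B).inter
      (isClosed_iInter fun a => hLc.preimage (ultrafilter_continuous_map _))
  have hJ : ∃ V ∈ J, V * V = V := by
    refine exists_idempotent_in_compact_subsemigroup Ultrafilter.continuous_mul_left J ?_
      hJc.isCompact ?_
    · refine ⟨pure (FreeMonoid.of none) * Ultrafilter.map (FreeMonoid.map some) q, ?_, ?_⟩
      · have h1 : ∀ᶠ x in ((pure (FreeMonoid.of none) *
            Ultrafilter.map (FreeMonoid.map some) q : Ultrafilter (FreeMonoid (Option A))) :
            Filter (FreeMonoid (Option A))), x ∈ B := by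
          rw [Ultrafilter.eventually_mul]
          simp [B]
        exact h1
      · simp only [Set.mem_iInter, Set.mem_preimage]
        intro a
        rw [ultrafilter_map_mul]
        refine hLi _ _ ?_
        have : Ultrafilter.map (subL a) (Ultrafilter.map (FreeMonoid.map some) q) = q := by
          rw [Ultrafilter.map_map]
          have h2 : (subL a) ∘ (FreeMonoid.map some) = (id : FreeMonoid A → FreeMonoid A) := by
            funext w
            induction w using FreeMonoid.inductionOn' with
            | one => simp
            | of_mul x xs ih =>
              simp only [Function.comp, map_mul, id] at ih ⊢
              rw [ih]; simp [subL]
          rw [h2]; simp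
        rw [this]; exact hq
    · rintro x ⟨hx, hx'⟩ y ⟨hy, hy'⟩
      refine ⟨?_, ?_⟩
      · refine (Ultrafilter.eventually_mul _ _ (· ∈ B)).2 ?_
        filter_upwards [hx] with m hm
        obtain ⟨z, rfl⟩ := hm
        exact Filter.Eventually.of_forall fun m' => ⟨z * m', mul_assoc _ _ _⟩
      · simp only [Set.mem_iInter, Set.mem_preimage] at hx' hy' ⊢
        intro a
        rw [ultrafilter_map_mul]
        exact hLi _ _ (hy' a)
  obtain ⟨V, ⟨hV1, hV2⟩, hVV⟩ := hJ
  refine ⟨V, hV1, fun a b => ?_⟩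
  simp only [Set.mem_iInter, Set.mem_preimage] at hV2
  obtain ⟨r, hr⟩ := hLm _ (hV2 a) _ (hV2 b)
  rw [hr, mul_assoc, ← ultrafilter_map_mul, hVV]

/-- the word obtained by substituting letters into a sequence of left variable words -/
def wd {A : Type} (w : List A) (x : ℕ → List (Option A)) (a : ℕ → A) : ℕ → List A
  | 0 => w
  | m + 1 => wd w x a m ++ (a m :: (x m).map (fun o => o.getD (a m)))

lemma words_ramsey (A : Type) [Finite A] [Nonempty A] (κ : Type) [Finite κ] (col' : List A → κ) :
    ∃ (κ0 : κ) (w : List A) (x : ℕ → List (Option A)), ∀ a m, col' (wd w x a m) = κ0 := by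
  classical
  let col : FreeMonoid A → κ := col'
  obtain ⟨V, hV, hVp⟩ := exists_good_ultrafilter A
  let a0 : A := Classical.arbitrary A
  let p : A → Ultrafilter (FreeMonoid A) := fun a => Ultrafilter.map (subL a) V
  have hpp : ∀ a b, p a * p b = p a := hVp
  obtain ⟨κ0, hκ0⟩ : ∃ κ0, ∀ᶠ w : FreeMonoid A in p a0, col w = κ0 := by
    by_contra hcon
    push Not at hcon
    have h1 : ∀ k : κ, ∀ᶠ w : FreeMonoid A in p a0, col w ≠ k := fun k => by
      exact hcon k
    have h2 := Filter.eventually_all.2 h1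
    obtain ⟨w, hw⟩ := h2.exists
    exact hw _ rfl
  let A1 : Set (FreeMonoid A) :=
    {w | col w = κ0 ∧ ∀ b, ∀ᶠ s in p b, col (w * s) = κ0}
  have hA1 : ∀ᶠ w in p a0, w ∈ A1 := by
    refine hκ0.and (Filter.eventually_all.2 fun b => ?_)
    have := hκ0
    rw [← hpp a0 b] at this
    exact this
  have hstep : ∀ w ∈ A1, ∀ᶠ x in V, ∀ b, w * subL b x ∈ A1 := by
    intro w hw
    refine Filter.eventually_all.2 fun b => ?_
    change ∀ᶠ s in p b, w * s ∈ A1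
    refine (hw.2 b).and (Filter.eventually_all.2 fun c => ?_)
    have := hw.2 b
    rw [← hpp b c, Ultrafilter.eventually_mul] at this
    simpa only [mul_assoc] using this
  obtain ⟨w, hw⟩ := hA1.exists
  have hex : ∀ F : {F : Finset (FreeMonoid A) // ∀ w ∈ F, w ∈ A1},
      ∃ y : FreeMonoid (Option A), ∀ w ∈ F.1, ∀ b, w * subL b (FreeMonoid.of none * y) ∈ A1 := by
    intro F
    have h1 : ∀ᶠ x in V, ∀ w ∈ F.1, ∀ b, w * subL b x ∈ A1 :=
      (Filter.eventually_all_finset F.1).2 fun w hw => hstep w (F.2 w hw)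
    obtain ⟨x, hx, y, rfl⟩ := (h1.and hV).exists
    exact ⟨y, hx⟩
  choose y hy using hex
  have := Fintype.ofFinite A
  let Fs : ℕ → {F : Finset (FreeMonoid A) // ∀ w ∈ F, w ∈ A1} := fun t =>
    Nat.rec ⟨{w}, by simpa using hw⟩ (fun _ F =>
      ⟨(F.1 ×ˢ Finset.univ).image (fun z => z.1 * subL z.2 (FreeMonoid.of none * y F)), by
        intro v hv
        simp only [Finset.mem_image, Finset.mem_product, Finset.mem_univ, and_true,
          Prod.exists] at hv
        obtain ⟨v', b, hv', rfl⟩ := hv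
        exact hy F v' hv' b⟩) t
  have hFs : ∀ t, (Fs (t + 1)).1 = ((Fs t).1 ×ˢ Finset.univ).image
      (fun z => z.1 * subL z.2 (FreeMonoid.of none * y (Fs t))) := fun t => rfl
  refine ⟨κ0, w, fun t => y (Fs t), fun a m => ?_⟩
  let wd' : ℕ → FreeMonoid A := fun m => wd w (fun t => y (Fs t)) a m
  have hwd : ∀ m, wd' (m + 1) = wd' m * subL (a m) (FreeMonoid.of none * y (Fs m)) :=
    fun m => rfl
  have : ∀ m, wd' m ∈ (Fs m).1 := by
    intro m
    induction m with
    | zero => exact Finset.mem_singleton_self _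
    | succ m ih =>
      rw [hFs, hwd, Finset.mem_image]
      refine ⟨(_, a m), Finset.mem_product.2 ⟨ih, Finset.mem_univ _⟩, ?_⟩
      rfl
  exact ((Fs m).2 _ (this m)).1

end UltrafilterPart

/-- extension of a word over `Fin n` to a rigid surjection -/
def extW (n : ℕ) (L : List (Fin n)) (i : ℕ) : ℕ :=
  if i < n then i else if h : i - n < L.length then (L[i - n] : ℕ) else i - L.length

lemma extW_RS (n : ℕ) (L : List (Fin n)) : RS n (extW n L) := by
  have h1 : ∀ i < n, extW n L i = i := fun i hi => by simp [extW, hi]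
  have h2 : ∀ v, n ≤ v → extW n L (v + L.length) = v := fun v hv => by
    rw [extW, if_neg (by omega), dif_neg (by omega)]; omega
  refine ⟨h1, fun i v hv => ?_, fun v => ?_⟩
  · by_cases hi : i < n
    · rw [h1 i hi] at hv
      exact ⟨v, hv, h1 v (by omega)⟩
    · by_cases hvn : v < n
      · exact ⟨v, by omega, h1 v hvn⟩
      · rw [extW, if_neg hi] at hv
        split_ifs at hv with h
        · have := (L[i - n]).2
          omega
        · exact ⟨v + L.length, by omega, h2 v (by omega)⟩
  · by_cases hvn : v < n
    · exact ⟨v, h1 v hvn⟩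
    · exact ⟨_, h2 v (by omega)⟩

/-- generic word -/
def genW {n : ℕ} (w : List (Fin n)) (x : ℕ → List (Option (Fin n))) : ℕ → List ℕ
  | 0 => w.map Fin.val
  | m + 1 => genW w x m ++ ((n + m) :: (x m).map (fun o => o.elim (n + m) Fin.val))

lemma genW_prefix {n : ℕ} (w : List (Fin n)) (x : ℕ → List (Option (Fin n))) (m s : ℕ) :
    genW w x m <+: genW w x (m + s) := by
  induction s with
  | zero => exact List.prefix_rfl
  | succ s ih => exact ih.trans (List.prefix_append _ _)

lemma genW_len {n : ℕ} (w : List (Fin n)) (x : ℕ → List (Option (Fin n))) (m : ℕ) :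
    m ≤ (genW w x m).length := by
  induction m with
  | zero => simp
  | succ m ih => simp only [genW, List.length_append, List.length_cons]; omega

lemma genW_lt {n : ℕ} (w : List (Fin n)) (x : ℕ → List (Option (Fin n))) (m : ℕ) :
    ∀ v ∈ genW w x m, v < n + m := by
  induction m with
  | zero =>
    intro v hv
    simp only [genW, List.mem_map] at hv
    obtain ⟨a, -, rfl⟩ := hv
    exact a.2
  | succ m ih =>
    intro v hv
    simp only [genW, List.mem_append, List.mem_cons, List.mem_map] at hv
    rcases hv with hv | rfl | ⟨o, -, rfl⟩
    · have := ih v hv; omega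
    · omega
    · cases o with
      | none => simp
      | some a => simp only [Option.elim]; omega

/-- the rigid surjection of the generic word -/
def genF {n : ℕ} (w : List (Fin n)) (x : ℕ → List (Option (Fin n))) (i : ℕ) : ℕ :=
  if i < n then i else ((genW w x (i - n + 1))[i - n]?).getD 0

lemma genF_eq {n : ℕ} (w : List (Fin n)) (x : ℕ → List (Option (Fin n))) (m j v : ℕ)
    (h : (genW w x m)[j]? = some v) : genF w x (n + j) = v := by
  have h0 : n + j - n = j := by omega
  rw [genF, if_neg (by omega), h0]
  have hlen : j < (genW w x (j + 1)).length := genW_len w x (j + 1)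
  have hlen2 : j < (genW w x m).length := by
    by_contra hc
    rw [List.getElem?_eq_none (by omega)] at h
    simp at h
  have : (genW w x (j + 1))[j]? = (genW w x m)[j]? := by
    rcases le_total m (j + 1) with hm | hm
    · obtain ⟨s, hs⟩ := Nat.exists_eq_add_of_le hm
      obtain ⟨t, ht⟩ := genW_prefix w x m s
      rw [hs, ← ht, List.getElem?_append_left hlen2]
    · obtain ⟨s, rfl⟩ := Nat.exists_eq_add_of_le hm
      obtain ⟨t, ht⟩ := genW_prefix w x (j + 1) s
      rw [← ht, List.getElem?_append_left hlen]
  rw [this, h]; rfl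

lemma genF_first {n : ℕ} (w : List (Fin n)) (x : ℕ → List (Option (Fin n))) (m : ℕ) :
    genF w x (n + (genW w x m).length) = n + m := by
  apply genF_eq w x (m + 1)
  simp [genW]

lemma genF_lt {n : ℕ} (w : List (Fin n)) (x : ℕ → List (Option (Fin n))) (m j : ℕ)
    (hj : j < (genW w x m).length) : genF w x (n + j) < n + m := by
  rw [genF_eq w x m j _ (List.getElem?_eq_getElem hj)]
  exact genW_lt w x m _ (List.getElem_mem hj)

lemma genF_RS {n : ℕ} (w : List (Fin n)) (x : ℕ → List (Option (Fin n))) : RS n (genF w x) := by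
  have h1 : ∀ i < n, genF w x i = i := fun i hi => by simp [genF, hi]
  refine ⟨h1, fun i v hv => ?_, fun v => ?_⟩
  · by_cases hi : i < n
    · rw [h1 i hi] at hv
      exact ⟨v, hv, h1 v (by omega)⟩
    · by_cases hvn : v < n
      · exact ⟨v, by omega, h1 v hvn⟩
      · obtain ⟨j, rfl⟩ := Nat.exists_eq_add_of_le (not_lt.mp hi)
        obtain ⟨m, rfl⟩ := Nat.exists_eq_add_of_le (not_lt.mp hvn)
        refine ⟨_, ?_, genF_first w x m⟩
        rcases lt_trichotomy j (genW w x m).length with h | h | h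
        · have := genF_lt w x m j h
          omega
        · rw [h, genF_first] at hv
          omega
        · omega
  · by_cases hvn : v < n
    · exact ⟨v, h1 v hvn⟩
    · obtain ⟨m, rfl⟩ := Nat.exists_eq_add_of_le (not_lt.mp hvn)
      exact ⟨_, genF_first w x m⟩

lemma CS_zero (n : ℕ) : CS n 0 := by
  intro κ hκ c hc
  rw [add_zero] at hc
  rcases Nat.eq_zero_or_pos n with rfl | hn
  · refine ⟨id, RS.id 0, fun U hU => ?_⟩
    refine hc _ _ (hU.comp (RS.id 0)) (RS.id 0) 0 ?_ (fun i hi => absurd hi (by omega)) ?_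
    · have := hU.le 0
      simp only [Function.comp, id]; omega
    · intro i hi
      have := hU.le i
      simp only [Function.comp, id]; omega
  have : Nonempty (Fin n) := ⟨⟨0, hn⟩⟩
  obtain ⟨κ0, w, x, hx⟩ := words_ramsey (Fin n) κ (fun L => c (extW n L))
  have key : ∀ U, RS n U → c (U ∘ genF w x) = κ0 := by
    intro U hU
    obtain ⟨l, hl, hl'⟩ := hU.first n
    have hnl : n ≤ l := by
      by_contra h
      have := hU.1 l (by omega)
      omega
    obtain ⟨m, rfl⟩ := Nat.exists_eq_add_of_le hnl
    let a : ℕ → Fin n := fun t => if h : t < m then ⟨U (n + t), hl' _ (by omega)⟩ else ⟨0, hn⟩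
    have hmap : ∀ t ≤ m, (genW w x t).map U = (wd w x a t).map Fin.val := by
      intro t
      induction t with
      | zero =>
        intro _
        simp only [genW, wd, List.map_map]
        refine List.map_congr_left fun b _ => ?_
        exact hU.1 _ b.2
      | succ t ih =>
        intro ht
        have hat : U (n + t) = (a t : ℕ) := by
          simp only [a]; rw [dif_pos (by omega)]
        simp only [genW, wd, List.map_append, List.map_cons, List.map_map]
        rw [ih (by omega), hat]
        congr 2
        refine List.map_congr_left fun o _ => ?_
        cases o with
        | none => simpa using hat
        | some b => simpa using hU.1 _ b.2
    have hm := hmap m le_rfl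
    have hlen : (genW w x m).length = (wd w x a m).length := by
      have := congrArg List.length hm
      simpa using this
    rw [← hx a m]
    have hfR := genF_RS w x
    refine hc _ _ (hU.comp hfR) (extW_RS n _) (n + (genW w x m).length) ?_ ?_ ?_
    · simp only [Function.comp]
      rw [genF_first, hl]
    · intro i hi
      simp only [Function.comp]
      refine hl' _ ?_
      by_cases hin : i < n
      · rw [hfR.1 i hin]; omega
      · obtain ⟨j, rfl⟩ := Nat.exists_eq_add_of_le (not_lt.mp hin)
        exact genF_lt w x m j (by omega)
    · intro i hi
      simp only [Function.comp]
      by_cases hin : i < n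
      · rw [hfR.1 i hin, hU.1 i hin, (extW_RS n _).1 i hin]
      · obtain ⟨j, rfl⟩ := Nat.exists_eq_add_of_le (not_lt.mp hin)
        rcases Nat.lt_or_ge j (genW w x m).length with hj | hj
        · rw [genF_eq w x m j _ (List.getElem?_eq_getElem hj), extW, if_neg hin,
            dif_pos (by omega)]
          have h3 : ((genW w x m).map U)[j]? = ((wd w x a m).map Fin.val)[j]? := by rw [hm]
          rw [List.getElem?_map, List.getElem?_map, List.getElem?_eq_getElem hj,
            List.getElem?_eq_getElem (by omega)] at h3
          simp only [Option.map_some, Option.some.injEq] at h3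
          rw [h3]
          simp
        · have : j = (genW w x m).length := by omega
          subst this
          rw [genF_first, hl, extW, if_neg hin, dif_neg (by omega)]
          omega
  refine ⟨genF w x, genF_RS w x, fun U hU => ?_⟩
  rw [key U hU]
  exact (key id (RS.id n)).symm

lemma CS_main (n k : ℕ) : CS n k := CS_all CS_zero k n

/-- coding of words into the graph -/
noncomputable def phi (adj : ℕ → ℕ → Prop) (v : List Bool) : ℕ :=
  Classical.epsilon (fun z => ∀ u : List Bool, ∀ _hu : u.length < v.length,
    phi adj u < z ∧ (adj z (phi adj u) ↔ v[u.length]? = some true))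
termination_by v.length

lemma phi_spec {adj : ℕ → ℕ → Prop}
    (hext : ∀ (U V : Finset ℕ) (N : ℕ), (∀ x ∈ U, x ∉ V) →
      ∃ z, N < z ∧ (∀ u ∈ U, adj z u) ∧ (∀ v ∈ V, ¬ adj z v)) :
    ∀ v u : List Bool, u.length < v.length →
      phi adj u < phi adj v ∧ (adj (phi adj v) (phi adj u) ↔ v[u.length]? = some true) := by
  classical
  suffices H : ∀ l, ∀ v : List Bool, v.length = l → ∀ u : List Bool, u.length < v.length →
      phi adj u < phi adj v ∧ (adj (phi adj v) (phi adj u) ↔ v[u.length]? = some true) from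
    fun v => H _ v rfl
  intro l
  induction l using Nat.strong_induction_on with
  | _ l ih =>
    intro v hv
    have hfin : {u : List Bool | u.length < l}.Finite := List.finite_length_lt Bool l
    let S := hfin.toFinset
    have hS : ∀ u, u ∈ S ↔ u.length < l := by simp [S]
    have hex : ∃ z, ∀ u : List Bool, ∀ _hu : u.length < v.length,
        phi adj u < z ∧ (adj z (phi adj u) ↔ v[u.length]? = some true) := by
      obtain ⟨z, hz, hzU, hzV⟩ := hext
        ((S.filter (fun u => v[u.length]? = some true)).image (phi adj))
        ((S.filter (fun u => ¬ v[u.length]? = some true)).image (phi adj))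
        (S.sup (phi adj)) (by
          intro x hx hx'
          simp only [Finset.mem_image, Finset.mem_filter, hS] at hx hx'
          obtain ⟨u, ⟨hu, hu'⟩, rfl⟩ := hx
          obtain ⟨y, ⟨hy, hy'⟩, hyu⟩ := hx'
          rcases lt_trichotomy u.length y.length with h | h | h
          · have := (ih _ hy y rfl u h).1
            omega
          · rw [h] at hu'
            exact hy' hu'
          · have := (ih _ hu u rfl y h).1
            omega)
      refine ⟨z, fun u hu => ⟨?_, ?_⟩⟩
      · have : phi adj u ≤ S.sup (phi adj) := Finset.le_sup ((hS u).2 (by omega))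
        omega
      · by_cases h : v[u.length]? = some true
        · simp only [h, iff_true]
          exact hzU _ (Finset.mem_image_of_mem _
            (Finset.mem_filter.2 ⟨(hS u).2 (by omega), h⟩))
        · simp only [h, iff_false]
          exact hzV _ (Finset.mem_image_of_mem _
            (Finset.mem_filter.2 ⟨(hS u).2 (by omega), h⟩))
    have := Classical.epsilon_spec hex
    rw [← phi] at this
    exact this

/-- finite words from functions -/
def mkW (l : ℕ) (b : ℕ → Bool) : List Bool := (List.range l).map b

lemma mkW_length (l : ℕ) (b : ℕ → Bool) : (mkW l b).length = l := by simp [mkW]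

lemma mkW_get {l : ℕ} (b : ℕ → Bool) {i : ℕ} (hi : i < l) : (mkW l b)[i]? = some (b i) := by
  simp [mkW, hi]

lemma mkW_congr {l : ℕ} {b b' : ℕ → Bool} (h : ∀ i < l, b i = b' i) : mkW l b = mkW l b' :=
  List.map_congr_left fun i hi => h i (List.mem_range.1 hi)

/-- first occurrence -/
noncomputable def pos (f : ℕ → ℕ) (v : ℕ) : ℕ := sInf {i | f i = v}

lemma pos_eq {f : ℕ → ℕ} {v i : ℕ} (h : f i = v) (h' : ∀ j < i, f j ≠ v) : pos f v = i := by
  apply le_antisymm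
  · exact Nat.sInf_le h
  · by_contra hc
    push Not at hc
    exact h' _ hc (Nat.sInf_mem (s := {i | f i = v}) ⟨i, h⟩)

lemma RS.pos_spec {n : ℕ} {f : ℕ → ℕ} (hf : RS n f) (v : ℕ) :
    f (pos f v) = v ∧ ∀ j < pos f v, f j < v := by
  obtain ⟨i, hi, hi'⟩ := hf.first v
  have := pos_eq hi (fun j hj => (hi' j hj).ne)
  rw [this]
  exact ⟨hi, hi'⟩

lemma RS.pos_lt {n : ℕ} {f : ℕ → ℕ} (hf : RS n f) {v v' : ℕ} (h : v < v') :
    pos f v < pos f v' := by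
  have h1 := (hf.pos_spec v').1
  obtain ⟨j, hj, hjv⟩ := hf.2.1 (pos f v') v (by omega)
  exact lt_of_le_of_lt (Nat.sInf_le hjv) hj

lemma RS.pos_comp {n : ℕ} {f U : ℕ → ℕ} (hU : RS n U) (hf : RS n f) (v : ℕ) :
    pos (U ∘ f) v = pos f (pos U v) := by
  apply pos_eq
  · simp only [Function.comp]
    rw [(hf.pos_spec _).1, (hU.pos_spec _).1]
  · intro j hj
    exact ((hU.pos_spec v).2 _ ((hf.pos_spec _).2 j hj)).ne

/-- the self-embedding attached to a rigid surjection -/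
noncomputable def wmap (adj : ℕ → ℕ → Prop) (f : ℕ → ℕ) (i : ℕ) : ℕ :=
  open Classical in phi adj (mkW (pos f i) (fun j => decide (adj i (f j))))

/-- the tuple of vertices coded by a rigid surjection and a finite type -/
noncomputable def tup {A : Type} (adj : ℕ → ℕ → Prop) {K : ℕ} (U : ℕ → ℕ)
    (q : (A → Fin K) × (Fin K → A → Bool)) (a : A) : ℕ :=
  phi adj (mkW (pos U (q.1 a)) (fun j => if h : U j < K then q.2 ⟨U j, h⟩ a else false))

lemma tup_dep {A : Type} (adj : ℕ → ℕ → Prop) {K : ℕ}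
    (q : (A → Fin K) × (Fin K → A → Bool)) : Dep 0 (0 + K) (fun U => tup adj U q) := by
  intro U U' hU hU' l hl hlt heq
  funext a
  have h1 : pos U (q.1 a) < l := by
    have := (q.1 a).2
    obtain ⟨j, hj, hjv⟩ := hU.2.1 l (q.1 a) (by omega)
    exact lt_of_le_of_lt (Nat.sInf_le hjv) hj
  have h2 : pos U' (q.1 a) = pos U (q.1 a) := by
    apply pos_eq
    · rw [heq _ h1.le, (hU.pos_spec _).1]
    · intro j hj
      rw [heq _ (by omega)]
      exact ((hU.pos_spec _).2 j hj).ne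
  simp only [tup]
  rw [h2]
  congr 1
  apply mkW_congr
  intro i hi
  rw [heq i (by omega)]

lemma rs_of_col {Y : Type} (col : ℕ → Y) (hinf : (Set.range col).Infinite) :
    ∃ U, RS 0 U ∧ ∀ i j, U i = U j ↔ col i = col j := by
  classical
  let P : ℕ → Prop := fun i => ∀ i' < i, col i' ≠ col i
  have hex : ∀ j, ∃ i, col i = col j := fun j => ⟨j, rfl⟩
  let fst : ℕ → ℕ := fun j => Nat.find (hex j)
  have hfst : ∀ j, col (fst j) = col j := fun j => Nat.find_spec (hex j)
  have hfstP : ∀ j, P (fst j) := fun j i' hi' h =>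
    Nat.find_min (hex j) hi' (h.trans (hfst j))
  have hfstle : ∀ j, fst j ≤ j := fun j => Nat.find_min' (hex j) rfl
  have hPfst : ∀ i, P i → fst i = i := by
    intro i hi
    by_contra h
    exact hi _ (lt_of_le_of_ne (hfstle i) h) (hfst i)
  have hPinf : {i | P i}.Infinite := by
    intro hfin
    refine hinf ((hfin.image col).subset ?_)
    rintro _ ⟨j, rfl⟩
    exact ⟨fst j, hfstP j, hfst j⟩
  have hU : ∀ v, P (Nat.nth P v) ∧ Nat.count P (Nat.nth P v) = v := fun v =>
    ⟨Nat.nth_mem_of_infinite hPinf v, Nat.count_nth_of_infinite hPinf v⟩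
  have hnth : ∀ v, Nat.count P (fst (Nat.nth P v)) = v := fun v => by
    rw [hPfst _ (hU v).1, (hU v).2]
  refine ⟨fun j => Nat.count P (fst j), ⟨fun i hi => absurd hi (by omega), ?_, ?_⟩, ?_⟩
  · intro i v hv
    refine ⟨Nat.nth P v, ?_, hnth v⟩
    refine lt_of_lt_of_le ?_ (hfstle i)
    by_contra hc
    have := Nat.count_monotone P (not_lt.mp hc)
    rw [(hU v).2] at this
    simp only at hv
    omega
  · intro v
    exact ⟨_, hnth v⟩
  · intro i j
    constructor
    · intro h
      have := Nat.count_injective (hfstP i) (hfstP j) h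
      rw [← hfst i, this, hfst j]
    · intro h
      have h1 : fst i = fst j := by
        apply le_antisymm
        · exact Nat.find_min' (hex i) ((hfst j).trans h.symm)
        · exact Nat.find_min' (hex j) ((hfst i).trans h)
      simp only [h1]

open Classical in
lemma envelope {A : Type} [Finite A] (adj : ℕ → ℕ → Prop) (g : A → ℕ) :
    ∃ U, RS 0 U ∧ ∃ q : (A → Fin (Nat.card (A → Option Bool))) ×
        (Fin (Nat.card (A → Option Bool)) → A → Bool),
      ∀ a, pos U (q.1 a) = g a ∧ ∀ j < g a, ∃ h : U j < Nat.card (A → Option Bool),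
        q.2 ⟨U j, h⟩ a = decide (adj (g a) j) := by
  let X : Type := A → Option Bool
  let cx : ℕ → X := fun j a => if j < g a then some (decide (adj (g a) j)) else none
  let col : ℕ → X ⊕ ℕ := fun j => if ∃ a, j ≤ g a then Sum.inl (cx j) else Sum.inr j
  have hcol : ∀ j a, j ≤ g a → col j = Sum.inl (cx j) := fun j a h => if_pos ⟨a, h⟩
  have hinf : (Set.range col).Infinite := by
    obtain ⟨M, hM⟩ := (Set.finite_range g).bddAbove
    have hbig : ∀ j, col (M + 1 + j) = Sum.inr (M + 1 + j) := by
      intro j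
      refine if_neg ?_
      rintro ⟨a, ha⟩
      have : g a ≤ M := hM ⟨a, rfl⟩
      omega
    refine Set.infinite_of_injective_forall_mem (f := fun j => col (M + 1 + j)) ?_
      (fun j => ⟨_, rfl⟩)
    intro i j hij
    simp only [hbig, Sum.inr.injEq] at hij
    omega
  obtain ⟨U, hU, hUc⟩ := rs_of_col col hinf
  have hb : ∀ j a, j ≤ g a → U j < Nat.card (A → Option Bool) := by
    intro j a hj
    have h1 : ∀ v : Fin (U j + 1), ∃ i ≤ j, U i = v := by
      intro v
      rcases Nat.lt_or_ge v (U j) with h | h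
      · obtain ⟨i, hi, hiv⟩ := hU.2.1 j v h
        exact ⟨i, hi.le, hiv⟩
      · exact ⟨j, le_rfl, by omega⟩
    choose i hi hiv using h1
    have h2 : Function.Injective (fun v => cx (i v)) := by
      intro v v' h
      simp only at h
      have : col (i v) = col (i v') := by
        rw [hcol _ a ((hi v).trans hj), hcol _ a ((hi v').trans hj), h]
      have := (hUc _ _).2 this
      rw [hiv, hiv] at this
      exact Fin.ext this
    have := Nat.card_le_card_of_injective _ h2
    simp only [Nat.card_fin] at this
    change U j + 1 ≤ Nat.card (A → Option Bool) at this
    omega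
  refine ⟨U, hU, (fun a => ⟨U (g a), hb _ a le_rfl⟩,
    fun v a => decide (∃ j < g a, U j = v ∧ adj (g a) j)), fun a => ⟨?_, ?_⟩⟩
  · apply pos_eq rfl
    intro j hj h
    have := (hUc _ _).1 h
    rw [hcol j a hj.le, hcol (g a) a le_rfl] at this
    have := congrFun (Sum.inl.inj this) a
    simp [cx, hj] at this
  · intro j hj
    refine ⟨hb j a hj.le, ?_⟩
    simp only [decide_eq_decide]
    constructor
    · rintro ⟨i, hi, hij, h⟩
      have := (hUc _ _).1 hij
      rw [hcol j a hj.le, hcol i a hi.le] at this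
      have := congrFun (Sum.inl.inj this) a
      simp only [cx, hi, hj, if_true, Option.some.injEq, decide_eq_decide] at this
      exact this.1 h
    · intro h
      exact ⟨j, hj, rfl, h⟩

lemma main_nat (adj : ℕ → ℕ → Prop) (hirr : ∀ x, ¬ adj x x) (hsym : ∀ x y, adj x y → adj y x)
    (hext : ∀ (U V : Finset ℕ) (N : ℕ), (∀ x ∈ U, x ∉ V) →
      ∃ z, N < z ∧ (∀ u ∈ U, adj z u) ∧ (∀ v ∈ V, ¬ adj z v))
    (A : Type) [Finite A] (adjA : A → A → Prop) (ra : A → A → Prop) :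
    ∃ T : ℕ, 0 < T ∧ ∀ k, 2 ≤ k →
      ∀ χ : {f : A → ℕ // LOGraphEmb adjA ra adj (· < ·) f} → Fin k,
        ∃ w : {g : ℕ → ℕ // LOGraphEmb adj (· < ·) adj (· < ·) g},
          (χ '' {p | ∃ f₀ : {f : A → ℕ // LOGraphEmb adjA ra adj (· < ·) f},
            p.val = w.val ∘ f₀.val}).ncard ≤ T := by
  classical
  let K := Nat.card (A → Option Bool)
  let Q := (A → Fin K) × (Fin K → A → Bool)
  have hphi := phi_spec hext
  refine ⟨Nat.card Q + 1, by omega, fun k hk χ => ?_⟩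
  let cc : (A → ℕ) → Option (Fin k) := fun t =>
    if h : LOGraphEmb adjA ra adj (· < ·) t then some (χ ⟨t, h⟩) else none
  obtain ⟨f, hf, hfc⟩ := CS_main 0 K (Q → Option (Fin k)) inferInstance
    (fun U q => cc (tup adj U q)) (by
      intro U U' hU hU' l hl hlt heq
      funext q
      exact congrArg cc (tup_dep adj q U U' hU hU' l hl hlt heq))
  have hlt : ∀ i j, i < j → wmap adj f i < wmap adj f j ∧
      (adj (wmap adj f j) (wmap adj f i) ↔ adj j i) := by
    intro i j hij
    have hp := hf.pos_lt hij
    have h := hphi (mkW (pos f j) (fun t => decide (adj j (f t))))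
      (mkW (pos f i) (fun t => decide (adj i (f t)))) (by rw [mkW_length, mkW_length]; exact hp)
    refine ⟨h.1, h.2.trans ?_⟩
    rw [mkW_length, mkW_get _ hp, (hf.pos_spec i).1]
    simp
  have hw : LOGraphEmb adj (· < ·) adj (· < ·) (wmap adj f) := by
    have hmono : StrictMono (wmap adj f) := fun i j h => (hlt i j h).1
    refine ⟨hmono.injective, fun x y => ?_, fun x y h => hmono h⟩
    rcases lt_trichotomy x y with h | h | h
    · have h1 := (hlt x y h).2
      exact ⟨fun h2 => hsym _ _ (h1.2 (hsym _ _ h2)), fun h2 => hsym _ _ (h1.1 (hsym _ _ h2))⟩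
    · subst h
      exact ⟨fun h => absurd h (hirr _), fun h => absurd h (hirr _)⟩
    · exact (hlt y x h).2.symm
  refine ⟨⟨wmap adj f, hw⟩, ?_⟩
  have hsub : (χ '' {p | ∃ f₀ : {f : A → ℕ // LOGraphEmb adjA ra adj (· < ·) f},
      p.val = wmap adj f ∘ f₀.val}) ⊆
      Set.range (fun q : Q => (cc (tup adj f q)).getD ⟨0, by omega⟩) := by
    rintro _ ⟨p, ⟨g, hg⟩, rfl⟩
    obtain ⟨U, hU, q, hq⟩ := envelope adj g.1
    have ht : tup adj (U ∘ f) q = p.1 := by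
      rw [hg]
      funext a
      simp only [tup, wmap, Function.comp]
      have h1 := hU.pos_comp hf (q.1 a)
      rw [(hq a).1] at h1
      rw [h1]
      congr 1
      apply mkW_congr
      intro i hi
      obtain ⟨h2, h3⟩ := (hq a).2 _ ((hf.pos_spec _).2 i hi)
      rw [dif_pos h2, h3]
    have h4 := congrFun (hfc U hU) q
    simp only [ht] at h4
    refine ⟨q, ?_⟩
    simp only
    rw [← h4]
    simp only [cc]
    rw [dif_pos p.2]
    rfl
  refine (Set.ncard_le_ncard hsub (Set.toFinite _)).trans ?_
  rw [← Set.image_univ]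
  refine (Set.ncard_image_le (Set.toFinite _)).trans ?_
  rw [Set.ncard_univ]
  omega

theorem stmt9
    -- `R` is a countable graph with the extension property (the random graph)
    (R : Type) (hRc : Countable R) (adj : R → R → Prop)
    (hirr : ∀ x, ¬ adj x x) (hsym : ∀ x y, adj x y → adj y x)
    (hext : ∀ U V : Finset R, (∀ x ∈ U, x ∉ V) →
      ∃ z : R, (∀ u ∈ U, adj z u) ∧ (∀ v ∈ V, ¬ adj z v))
    -- `⊏` is a linear order on the vertex set of `R` of order type `ω`
    (lt : R → R → Prop) (hlt : IsStrictTotalOrder R lt)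
    (homega : ∃ e : R ≃ ℕ, ∀ x y : R, lt x y ↔ e x < e y)
    -- a finite linearly ordered graph `(A, adjA, ra)`
    (A : Type) (hAfin : Finite A) (adjA : A → A → Prop)
    (hAirr : ∀ x, ¬ adjA x x) (hAsym : ∀ x y, adjA x y → adjA y x)
    (ra : A → A → Prop) (hra : IsStrictTotalOrder A ra) :
    ∃ T : ℕ, 0 < T ∧ ∀ k, 2 ≤ k →
      ∀ χ : {f : A → R // LOGraphEmb adjA ra adj lt f} → Fin k,
        ∃ w : {g : R → R // LOGraphEmb adj lt adj lt g},
          (χ '' {p | ∃ f₀ : {f : A → R // LOGraphEmb adjA ra adj lt f},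
            p.val = w.val ∘ f₀.val}).ncard ≤ T := by
  classical
  obtain ⟨e, he⟩ := homega
  let adjN : ℕ → ℕ → Prop := fun i j => adj (e.symm i) (e.symm j)
  have hextN : ∀ (U V : Finset ℕ) (N : ℕ), (∀ x ∈ U, x ∉ V) →
      ∃ z, N < z ∧ (∀ u ∈ U, adjN z u) ∧ (∀ v ∈ V, ¬ adjN z v) := by
    intro U V N hUV
    let m : Finset ℕ → Finset R := fun S => S.map e.symm.toEmbedding
    have hm : ∀ S x, x ∈ m S ↔ e x ∈ S := by
      intro S x
      simp only [m, Finset.mem_map, Equiv.coe_toEmbedding]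
      constructor
      · rintro ⟨a, ha, rfl⟩
        simpa using ha
      · intro h
        exact ⟨e x, h, by simp⟩
    obtain ⟨y, hy, -⟩ := hext (m (U ∪ V ∪ Finset.range (N + 1))) ∅ (by simp)
    have hyU : y ∉ m U := fun h => hirr y (hy y (by
      rw [hm] at h ⊢
      simp [h]))
    obtain ⟨z, hzU, hzV⟩ := hext (m U) (insert y (m V)) (by
      intro x hx hx'
      rcases Finset.mem_insert.1 hx' with rfl | h
      · exact hyU hx
      · rw [hm] at hx h
        exact hUV _ hx h)
    refine ⟨e z, ?_, ?_, ?_⟩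
    · by_contra hc
      refine hzV y (Finset.mem_insert_self _ _) (hsym _ _ (hy z ?_))
      rw [hm]
      simp only [Finset.mem_union, Finset.mem_range]
      right; omega
    · intro u hu
      simp only [adjN, Equiv.symm_apply_apply]
      exact hzU _ (by rw [hm]; simpa using hu)
    · intro v hv
      simp only [adjN, Equiv.symm_apply_apply]
      exact hzV _ (Finset.mem_insert_of_mem (by rw [hm]; simpa using hv))
  obtain ⟨T, hT, H⟩ := main_nat adjN (fun x => hirr _) (fun x y => hsym _ _) hextN A adjA ra
  refine ⟨T, hT, fun k hk χ => ?_⟩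
  have hto : ∀ f : A → ℕ, LOGraphEmb adjA ra adjN (· < ·) f →
      LOGraphEmb adjA ra adj lt (e.symm ∘ f) := by
    rintro f ⟨h1, h2, h3⟩
    refine ⟨e.symm.injective.comp h1, h2, fun x y h => ?_⟩
    rw [he]
    simpa using h3 x y h
  have hfrom : ∀ f : A → R, LOGraphEmb adjA ra adj lt f →
      LOGraphEmb adjA ra adjN (· < ·) (e ∘ f) := by
    rintro f ⟨h1, h2, h3⟩
    refine ⟨e.injective.comp h1, fun x y => ?_, fun x y h => ?_⟩
    · simpa [adjN] using h2 x y
    · exact (he _ _).1 (h3 x y h)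
  obtain ⟨⟨w, hw1, hw2, hw3⟩, hw⟩ := H k hk (fun f => χ ⟨e.symm ∘ f.1, hto f.1 f.2⟩)
  refine ⟨⟨e.symm ∘ w ∘ e, (e.symm.injective.comp hw1).comp e.injective, fun x y => ?_,
    fun x y h => ?_⟩, ?_⟩
  · have := hw2 (e x) (e y)
    simpa [adjN] using this
  · rw [he]
    simpa using hw3 _ _ ((he _ _).1 h)
  · refine (Set.ncard_le_ncard ?_ (Set.toFinite _)).trans hw
    rintro _ ⟨p, ⟨g, hg⟩, rfl⟩
    refine ⟨⟨e ∘ p.1, hfrom p.1 p.2⟩, ⟨⟨e ∘ g.1, hfrom g.1 g.2⟩, ?_⟩, ?_⟩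
    · simp only [hg]
      funext a
      simp
    · simp only
      congr 1
      apply Subtype.ext
      funext a
      simp
end
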